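/- Let X be a smooth plane dendroid with initial point p. If E(X) is hereditarily disconnected, then E(X) \ {p} is almost zero-dimensional. -/

import Mathlib

open Set Filter Topology

/-- The Euclidean plane. -/
abbrev Plane := EuclideanSpace ℝ (Fin 2)

section Defs

variable {α : Type*} [TopologicalSpace α]

/-- `A` is an arc with endpoints `a` and `b`: a homeomorphic image of `[0,1]`
sending `0 ↦ a` and `1 ↦ b`. -/
def IsArcWithEndpoints (A : Set α) (a b : α) : Prop :=
  ∃ f : ℝ → α, ContinuousOn f (Set.Icc 0 1) ∧ Set.InjOn f (Set.Icc 0 1) ∧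
    f '' (Set.Icc 0 1) = A ∧ f 0 = a ∧ f 1 = b

/-- `A` is an arc. -/
def IsArc (A : Set α) : Prop := ∃ a b, IsArcWithEndpoints A a b

/-- Every two distinct points of `X` are joined by an arc inside `X`. -/
def ArcwiseConnected (X : Set α) : Prop :=
  ∀ x ∈ X, ∀ y ∈ X, x ≠ y → ∃ A, A ⊆ X ∧ IsArcWithEndpoints A x y

/-- Every two subcontinua of `X` have connected intersection. -/
def HereditarilyUnicoherent (X : Set α) : Prop :=
  ∀ K L : Set α, K ⊆ X → L ⊆ X → IsCompact K → IsConnected K →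
    IsCompact L → IsConnected L → IsPreconnected (K ∩ L)

/-- A dendroid: a hereditarily unicoherent, arcwise connected continuum. -/
def IsDendroid (X : Set α) : Prop :=
  IsCompact X ∧ IsConnected X ∧ HereditarilyUnicoherent X ∧ ArcwiseConnected X

/-- The set of endpoints of `X`: points that are endpoints of every arc in `X`
containing them. -/
def Endpoints (X : Set α) : Set α :=
  {e | e ∈ X ∧ ∀ A : Set α, A ⊆ X → IsArc A → e ∈ A → ∃ b, IsArcWithEndpoints A e b}

/-- `X` is Suslinian: every collection of pairwise-disjoint non-degenerate
subcontinua of `X` is countable. -/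
def IsSuslinian (X : Set α) : Prop :=
  ∀ S : Set (Set α), (∀ K ∈ S, K ⊆ X ∧ IsCompact K ∧ IsConnected K ∧ K.Nontrivial) →
    S.PairwiseDisjoint id → S.Countable

/-- The arc component of `x` inside the set `S`. -/
def arcComponentIn (S : Set α) (x : α) : Set α :=
  {y | y ∈ S ∧ (y = x ∨ ∃ A, A ⊆ S ∧ IsArcWithEndpoints A x y)}

/-- The collection of arc components of `X \ {x}`; its cardinality is the order of `x`. -/
def orderComponents (X : Set α) (x : α) : Set (Set α) :=
  {C | ∃ y ∈ X \ {x}, C = arcComponentIn (X \ {x}) y}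

/-- Ramification points of `X`: points of order at least 3. -/
def RamificationPoints (X : Set α) : Set α :=
  {x | x ∈ X ∧ 3 ≤ (orderComponents X x).encard}

/-- `A` is a clopen subset of the subspace `Y`. -/
def IsClopenIn (Y A : Set α) : Prop :=
  A ⊆ Y ∧ (∃ U, IsOpen U ∧ A = Y ∩ U) ∧ (∃ C, IsClosed C ∧ A = Y ∩ C)

/-- The quasicomponent of `x` in the subspace `Y`: the intersection of all
clopen subsets of `Y` containing `x`. -/
def quasicomponentIn (Y : Set α) (x : α) : Set α :=
  {y ∈ Y | ∀ A : Set α, IsClopenIn Y A → x ∈ A → y ∈ A}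

/-- `Y` is hereditarily disconnected: it contains no non-degenerate connected subset. -/
def HereditarilyDisconnected (Y : Set α) : Prop :=
  ∀ S : Set α, S ⊆ Y → IsPreconnected S → S.Subsingleton

end Defs

/-- The point `x` of `X` is (arcwise) accessible from `ℝ² \ X`. -/
def AccessiblePoint (X : Set Plane) (x : Plane) : Prop :=
  ∃ A : Set Plane, IsArc A ∧ A ∩ X = {x}

/-- `σ` separates the points `b` and `d` in the plane: no connected subset of the
complement of `σ` contains both. -/
def SeparatesPoints (σ : Set Plane) (b d : Plane) : Prop :=
  b ∉ σ ∧ d ∉ σ ∧ ∀ K : Set Plane, K ⊆ σᶜ → IsPreconnected K → b ∈ K → d ∉ K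

/-- A simple closed curve in the plane: the image of a period-1 parametrization
injective on `[0,1)`. -/
def IsSimpleClosedCurve (O : Set Plane) : Prop :=
  ∃ f : ℝ → Plane, Continuous f ∧ Function.Periodic f 1 ∧
    Set.InjOn f (Set.Ico 0 1) ∧ f '' (Set.Ico 0 1) = O

/-- The dendroid `X` is smooth at `p`: there is a choice `arcTo x` of the unique arc
from `x` to `p` (reduced to `{p}` for `x = p`) such that `xₙ → x` in `X` implies
`arcTo xₙ → arcTo x` in the Hausdorff distance. -/
def DendroidSmoothAt (X : Set Plane) (p : Plane) : Prop :=
  p ∈ X ∧ ∃ arcTo : Plane → Set Plane,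
    arcTo p = {p} ∧
    (∀ x ∈ X, x ≠ p → arcTo x ⊆ X ∧ IsArcWithEndpoints (arcTo x) x p) ∧
    (∀ (xs : ℕ → Plane) (x : Plane), (∀ n, xs n ∈ X) → x ∈ X →
      Filter.Tendsto xs Filter.atTop (nhds x) →
      Filter.Tendsto (fun n => EMetric.hausdorffEdist (arcTo (xs n)) (arcTo x))
        Filter.atTop (nhds 0))

/-- A space is zero-dimensional if it has a basis of clopen sets. -/
def IsZeroDimensionalSpace (β : Type*) [TopologicalSpace β] : Prop :=
  ∀ (x : β) (U : Set β), IsOpen U → x ∈ U → ∃ V : Set β, IsClopen V ∧ x ∈ V ∧ V ⊆ U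

/-- A space is almost zero-dimensional if it has a neighborhood basis of sets
which are intersections of clopen sets. -/
def IsAlmostZeroDimensionalSpace (β : Type*) [TopologicalSpace β] : Prop :=
  ∀ (x : β) (U : Set β), IsOpen U → x ∈ U →
    ∃ V : Set β, V ∈ nhds x ∧ V ⊆ U ∧
      ∃ 𝒞 : Set (Set β), (∀ C ∈ 𝒞, IsClopen C) ∧ V = ⋂₀ 𝒞

/-- The union of `W` with all of the bounded connected components of its complement. -/
def boundedComplementaryFill (W : Set Plane) : Set Plane :=
  W ∪ ⋃₀ {K | (∃ x ∈ Wᶜ, K = connectedComponentIn Wᶜ x) ∧ Bornology.IsBounded K}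

/-- A Bellamy dendroid: a (non-degenerate) smooth plane dendroid whose endpoint
set is connected. -/
def IsBellamyDendroid (K : Set Plane) : Prop :=
  IsDendroid K ∧ K.Nontrivial ∧ (∃ q, DendroidSmoothAt K q) ∧ IsConnected (Endpoints K)

/-- The middle-thirds Cantor set. -/
noncomputable def cantorC : Set ℝ :=
  {x | ∃ a : ℕ → Bool, x = ∑' i, (if a i then (2 : ℝ) else 0) / 3 ^ (i + 1)}

namespace PlaneLog

/-- `g` is a continuous logarithm of `F` on `s`. -/
def IsLogOn {α : Type*} [TopologicalSpace α] (g F : α → ℂ) (s : Set α) : Prop :=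
  ContinuousOn g s ∧ ∀ z ∈ s, Complex.exp (g z) = F z

/-- `F` has a continuous logarithm on `s`. -/
def HasLogOn {α : Type*} [TopologicalSpace α] (F : α → ℂ) (s : Set α) : Prop :=
  ∃ g, IsLogOn g F s

section General

variable {α : Type*} [TopologicalSpace α]

lemma IsLogOn.mono {g F : α → ℂ} {s t : Set α} (h : IsLogOn g F s) (ht : t ⊆ s) :
    IsLogOn g F t :=
  ⟨h.1.mono ht, fun z hz => h.2 z (ht hz)⟩

lemma HasLogOn.mono {F : α → ℂ} {s t : Set α} (h : HasLogOn F s) (ht : t ⊆ s) :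
    HasLogOn F t :=
  h.imp fun _ hg => hg.mono ht

lemma HasLogOn.congr {F G : α → ℂ} {s : Set α} (h : HasLogOn F s)
    (hFG : ∀ z ∈ s, F z = G z) : HasLogOn G s :=
  h.imp fun _ hg => ⟨hg.1, fun z hz => (hg.2 z hz).trans (hFG z hz)⟩

lemma HasLogOn.mul {F G : α → ℂ} {s : Set α} (hF : HasLogOn F s) (hG : HasLogOn G s) :
    HasLogOn (fun z => F z * G z) s := by
  obtain ⟨f, hf⟩ := hF
  obtain ⟨g, hg⟩ := hG
  exact ⟨fun z => f z + g z, hf.1.add hg.1, fun z hz => by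
    rw [Complex.exp_add, hf.2 z hz, hg.2 z hz]⟩

lemma HasLogOn.inv {F : α → ℂ} {s : Set α} (hF : HasLogOn F s) :
    HasLogOn (fun z => (F z)⁻¹) s := by
  obtain ⟨f, hf⟩ := hF
  exact ⟨fun z => - f z, hf.1.neg, fun z hz => by rw [Complex.exp_neg, hf.2 z hz]⟩

lemma eq_zero_of_exp_eq_one {w : ℂ} (h : Complex.exp w = 1) (hw : ‖w‖ < 1) : w = 0 := by
  obtain ⟨n, hn⟩ := Complex.exp_eq_one_iff.1 h
  rcases eq_or_ne n 0 with rfl | h0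
  · simpa using hn
  · exfalso
    have h1 : (1 : ℝ) ≤ |(n : ℝ)| := by exact_mod_cast Int.one_le_abs h0
    have h2 : ‖w‖ = |(n : ℝ)| * (2 * Real.pi) := by
      rw [hn]; simp [abs_of_pos Real.pi_pos]
    nlinarith [Real.pi_gt_three]

/-- Two logarithms of the same function on a preconnected set differ by a constant. -/
lemma sub_eq_sub_of_exp_eq {g₁ g₂ : α → ℂ} {s : Set α} (hs : IsPreconnected s)
    (h₁ : ContinuousOn g₁ s) (h₂ : ContinuousOn g₂ s)
    (h : ∀ z ∈ s, Complex.exp (g₁ z) = Complex.exp (g₂ z)) {x y : α} (hx : x ∈ s) (hy : y ∈ s) :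
    g₁ x - g₂ x = g₁ y - g₂ y := by
  refine hs.induction₂ (fun x y => g₁ x - g₂ x = g₁ y - g₂ y) ?_ ?_ ?_ hx hy
  · intro x hx
    have hc : ContinuousWithinAt (fun z => g₁ z - g₂ z) s x := (h₁.sub h₂) x hx
    filter_upwards [hc (Metric.ball_mem_nhds _ one_pos), self_mem_nhdsWithin] with y hy hys
    have e : ∀ z ∈ s, Complex.exp (g₁ z - g₂ z) = 1 := fun z hz => by
      rw [Complex.exp_sub, h z hz, div_self (Complex.exp_ne_zero _)]
    have := eq_zero_of_exp_eq_one (w := (g₁ y - g₂ y) - (g₁ x - g₂ x))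
      (by rw [Complex.exp_sub, e y hys, e x hx, div_one]) (by
        simpa [dist_eq_norm] using hy)
    exact (sub_eq_zero.1 this).symm
  · intro x y z _ _ _ h1 h2; exact h1.trans h2
  · intro x y _ _ h; exact h.symm

lemma IsLogOn.sub_eq_sub {g₁ g₂ F : α → ℂ} {s : Set α} (h₁ : IsLogOn g₁ F s)
    (h₂ : IsLogOn g₂ F s) (hs : IsPreconnected s) {x y : α} (hx : x ∈ s) (hy : y ∈ s) :
    g₁ x - g₂ x = g₁ y - g₂ y :=
  sub_eq_sub_of_exp_eq hs h₁.1 h₂.1 (fun z hz => (h₁.2 z hz).trans (h₂.2 z hz).symm) hx hy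

lemma IsLogOn.eqOn {g₁ g₂ F : α → ℂ} {s : Set α} (h₁ : IsLogOn g₁ F s)
    (h₂ : IsLogOn g₂ F s) (hs : IsPreconnected s) {x : α} (hx : x ∈ s) (h : g₁ x = g₂ x) :
    EqOn g₁ g₂ s := fun y hy => by
  have := h₁.sub_eq_sub h₂ hs hx hy
  rw [h, sub_self] at this
  exact (sub_eq_zero.1 this.symm)

lemma exists_continuous_log {F : α → ℂ} [SimplyConnectedSpace α] [LocallyPathConnectedSpace α]
    (hF : Continuous F) (h0 : ∀ z, F z ≠ 0) :
    ∃ G : α → ℂ, Continuous G ∧ ∀ z, Complex.exp (G z) = F z := by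
  obtain ⟨x₀⟩ : Nonempty α := inferInstance
  obtain ⟨G, ⟨-, hG⟩, -⟩ := Complex.isCoveringMapOn_exp.existsUnique_continuousMap_lifts
    (⟨F, hF⟩ : C(α, ℂ)) (a₀ := x₀) (e₀ := Complex.log (F x₀)) (Complex.exp_log (h0 x₀))
    (fun a => h0 a)
  exact ⟨G, G.continuous, fun z => congrFun hG z⟩

end General

/-- The identity `z - q` has no continuous logarithm on a circle enclosing `q`. -/
lemma not_hasLogOn_sphere {c q : ℂ} {R : ℝ} (hq : q ∈ Metric.ball c R) :
    ¬ HasLogOn (fun z => z - q) (Metric.sphere c R) := by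
  rintro ⟨g, hg⟩
  have hR : 0 < R := dist_nonneg.trans_lt hq
  have hnorm : ‖(c - q) / R‖ < 1 := by
    rw [norm_div, Complex.norm_real, Real.norm_of_nonneg hR.le, div_lt_one hR]
    rw [Metric.mem_ball, dist_comm, dist_eq_norm] at hq
    exact hq
  have hslit : ∀ t : ℝ, 1 + (c - q) / R * Complex.exp (-(t * Complex.I)) ∈ Complex.slitPlane := by
    intro t
    apply Complex.mem_slitPlane_of_norm_lt_one
    rw [norm_mul, ← neg_mul, ← Complex.ofReal_neg, Complex.norm_exp_ofReal_mul_I, mul_one]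
    exact hnorm
  have hmem : ∀ t : ℝ, c + R * Complex.exp (t * Complex.I) ∈ Metric.sphere c R := fun t => by
    simp [Complex.norm_exp_ofReal_mul_I, hR.le]
  have e : ∀ t : ℝ, Complex.exp (g (c + R * Complex.exp (t * Complex.I))) =
      Complex.exp (Complex.log R + t * Complex.I +
        Complex.log (1 + (c - q) / R * Complex.exp (-(t * Complex.I)))) := by
    intro t
    rw [hg.2 _ (hmem t), Complex.exp_add, Complex.exp_add,
      Complex.exp_log (Complex.slitPlane_ne_zero (hslit t)),
      Complex.exp_log (by exact_mod_cast hR.ne'), Complex.exp_neg]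
    have := Complex.exp_ne_zero (t * Complex.I)
    have : (R : ℂ) ≠ 0 := by exact_mod_cast hR.ne'
    field_simp
    ring
  have := sub_eq_sub_of_exp_eq (s := (univ : Set ℝ)) isPreconnected_univ
    (g₁ := fun t : ℝ => g (c + R * Complex.exp (t * Complex.I)))
    (g₂ := fun t : ℝ => Complex.log R + t * Complex.I +
        Complex.log (1 + (c - q) / R * Complex.exp (-(t * Complex.I))))
    (hg.1.comp (by fun_prop) fun t _ => hmem t)
    (by
      refine ContinuousOn.add (by fun_prop) (ContinuousOn.clog (by fun_prop) fun t _ => hslit t))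
    (fun t _ => e t) (mem_univ 0) (mem_univ (2 * Real.pi))
  have h2 : Complex.exp (-((2 * Real.pi : ℝ) * Complex.I)) = 1 := by
    rw [Complex.exp_neg]; push_cast; rw [Complex.exp_two_pi_mul_I, inv_one]
  have h3 : Complex.exp (((2 * Real.pi : ℝ) : ℂ) * Complex.I) = 1 := by
    push_cast; exact Complex.exp_two_pi_mul_I
  simp only [h2, h3] at this
  simp at this

/-- Gluing lemma for logarithms along the frontier of an open set. -/
lemma hasLogOn_of_glue {O J : Set ℂ} (hO : IsOpen O) (hJ : IsClosed J) (hfr : frontier O ⊆ J)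
    {a b g : ℂ → ℂ} (ha : ContinuousOn a (closure O)) (ha0 : ∀ z ∈ closure O, a z ≠ 0)
    (hb : ContinuousOn b Oᶜ) (hb0 : ∀ z ∈ Oᶜ, b z ≠ 0) (hg : ContinuousOn g J)
    (hab : ∀ z ∈ J, a z = b z * Complex.exp (g z)) :
    HasLogOn a (closure O) ∧ HasLogOn b Oᶜ := by
  classical
  obtain ⟨G, hG⟩ := ContinuousMap.exists_restrict_eq hJ
    ⟨J.domRestrict g, continuousOn_iff_continuous_domRestrict.mp hg⟩
  have hGg : ∀ z ∈ J, G z = g z := fun z hz => DFunLike.congr_fun hG ⟨z, hz⟩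
  set Φ : ℂ → ℂ := fun z => if z ∈ O then a z else b z * Complex.exp (G z) with hΦ
  have hcl : ∀ z ∈ closure O, z ∉ O → z ∈ J := fun z hz hzO =>
    hfr (by rw [hO.frontier_eq]; exact ⟨hz, hzO⟩)
  have hΦa : ∀ z ∈ closure O, Φ z = a z := by
    intro z hz
    by_cases hzO : z ∈ O
    · simp [hΦ, hzO]
    · have := hcl z hz hzO
      simp [hΦ, hzO, hab z this, hGg z this]
  have hΦb : ∀ z ∈ Oᶜ, Φ z = b z * Complex.exp (G z) := fun z hz => if_neg hz
  have hc : Continuous Φ := by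
    rw [← continuousOn_univ]
    have h1 : ContinuousOn Φ (closure O) := ha.congr hΦa
    have h2 : ContinuousOn Φ Oᶜ :=
      (hb.mul (Complex.continuous_exp.comp G.continuous).continuousOn).congr hΦb
    refine (h1.union_of_isClosed h2 isClosed_closure hO.isClosed_compl).mono fun z _ => ?_
    by_cases hz : z ∈ O
    · exact Or.inl (subset_closure hz)
    · exact Or.inr hz
  obtain ⟨L, hL, hLe⟩ := exists_continuous_log hc fun z => by
    by_cases hz : z ∈ O
    · rw [hΦa z (subset_closure hz)]; exact ha0 z (subset_closure hz)
    · rw [hΦb z hz]; exact mul_ne_zero (hb0 z hz) (Complex.exp_ne_zero _)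
  refine ⟨⟨L, hL.continuousOn, fun z hz => (hLe z).trans (hΦa z hz)⟩,
    ⟨fun z => L z - G z, (hL.sub G.continuous).continuousOn, fun z hz => ?_⟩⟩
  rw [Complex.exp_sub, hLe, hΦb z hz, mul_div_cancel_right₀ _ (Complex.exp_ne_zero _)]

/-- Points in the same component of the complement of a closed set. -/
lemma hasLogOn_div_of_isPreconnected {K C : Set ℂ} (hK : IsClosed K) (hC : IsPreconnected C)
    (hCK : ∀ z ∈ C, z ∉ K) {a b : ℂ} (ha : a ∈ C) (hb : b ∈ C) :
    HasLogOn (fun z => (z - a) / (z - b)) K := by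
  have hne : ∀ x ∈ C, ∀ z ∈ K, z - x ≠ 0 := fun x hx z hz h =>
    hCK x hx (by rwa [← sub_eq_zero.1 h])
  refine hC.induction₂ (fun a b => HasLogOn (fun z => (z - a) / (z - b)) K) ?_ ?_ ?_ ha hb
  · intro x hx
    obtain ⟨ε, hε, hball⟩ := Metric.isOpen_iff.1 hK.isOpen_compl x (hCK x hx)
    filter_upwards [mem_nhdsWithin_of_mem_nhds (Metric.ball_mem_nhds x hε),
      self_mem_nhdsWithin] with y hy hyC
    have hsl : ∀ z ∈ K, 1 + (x - y) / (z - x) ∈ Complex.slitPlane := by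
      intro z hz
      apply Complex.mem_slitPlane_of_norm_lt_one
      have h1 : ε ≤ ‖z - x‖ := by
        by_contra! h
        exact hball (by rwa [Metric.mem_ball, dist_eq_norm]) hz
      rw [norm_div, div_lt_one (hε.trans_le h1)]
      rw [Metric.mem_ball, dist_comm, dist_eq_norm] at hy
      exact hy.trans_le h1
    have : HasLogOn (fun z => (z - y) / (z - x)) K := by
      refine ⟨fun z => Complex.log (1 + (x - y) / (z - x)), ?_, ?_⟩
      · refine ContinuousOn.clog ?_ hsl
        exact continuousOn_const.add (continuousOn_const.div (by fun_prop) (hne x hx))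
      · intro z hz
        rw [Complex.exp_log (Complex.slitPlane_ne_zero (hsl z hz))]
        have := hne x hx z hz
        field_simp
        ring
    exact this.inv.congr fun z hz => by rw [inv_div]
  · intro x y z hx hy hz h1 h2
    exact (h1.mul h2).congr fun w hw => by
      have := hne y hy w hw; have := hne z hz w hw
      field_simp
  · intro x y hx hy h
    exact h.inv.congr fun z hz => by rw [inv_div]

/-- Spheres in the plane are preconnected. -/
lemma isPreconnected_sphere_complex (c : ℂ) (R : ℝ) : IsPreconnected (Metric.sphere c R) :=
  isPreconnected_sphere (by rw [Complex.rank_real_complex]; norm_num) c R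

/-- A large circle lies in `O` or in `Oᶜ` whenever the frontier of `O` is bounded. -/
lemma exists_sphere_subset {O J : Set ℂ} (hO : IsOpen O) (hJ : Bornology.IsBounded J) (hfr : frontier O ⊆ J)
    (r₀ : ℝ) : ∃ R > r₀, Metric.sphere (0 : ℂ) R ⊆ O ∨ Metric.sphere (0 : ℂ) R ⊆ Oᶜ := by
  obtain ⟨r, hr⟩ := hJ.subset_ball (0 : ℂ)
  refine ⟨max r₀ r + 1, by linarith [le_max_left r₀ r], ?_⟩
  set R := max r₀ r + 1
  by_cases h : (Metric.sphere (0 : ℂ) R ∩ O).Nonempty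
  · left
    refine (isPreconnected_sphere_complex 0 R).subset_of_closure_inter_subset hO h ?_
    rintro z ⟨hz, hzs⟩
    by_contra hzO
    have := hr (hfr (by rw [hO.frontier_eq]; exact ⟨hz, hzO⟩))
    rw [Metric.mem_ball] at this
    rw [Metric.mem_sphere] at hzs
    have : r ≤ max r₀ r := le_max_right _ _
    simp only [R] at hzs
    linarith
  · right
    intro z hz hzO
    exact h ⟨z, hz, hzO⟩

/-- If `(z - y) / (z - m)` has a logarithm on `J`, then the component of `y` in the complement
of `J` contains `m`. -/
lemma mem_of_hasLogOn_div {J O : Set ℂ} {y m : ℂ} (hJ : IsCompact J) (hy : y ∉ J) (hm : m ∉ J)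
    (hlog : HasLogOn (fun z => (z - y) / (z - m)) J) (hO : IsOpen O) (hfr : frontier O ⊆ J)
    (hyO : y ∈ O) : m ∈ O := by
  by_contra hmO
  obtain ⟨g, hg⟩ := hlog
  have hmc : m ∉ closure O := fun h => hm (hfr (by rw [hO.frontier_eq]; exact ⟨h, hmO⟩))
  have hz : ∀ (x : ℂ) (s : Set ℂ), x ∉ s → ∀ z ∈ s, z - x ≠ 0 := fun x s hx z hz h =>
    hx (by rwa [← sub_eq_zero.1 h])
  obtain ⟨h1, h2⟩ := hasLogOn_of_glue hO hJ.isClosed hfr (a := fun z => z - m)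
    (b := fun z => z - y) (g := fun z => - g z) (by fun_prop) (hz m _ hmc) (by fun_prop)
    (hz y _ fun h => h hyO) hg.1.neg (fun z hzJ => by
      have := hz m _ hm z hzJ
      have := hz y _ hy z hzJ
      rw [Complex.exp_neg, hg.2 z hzJ]
      field_simp)
  obtain ⟨R, hR, hs⟩ := exists_sphere_subset hO hJ.isBounded hfr (max ‖y‖ ‖m‖)
  rcases hs with hs | hs
  · exact not_hasLogOn_sphere (c := 0) (q := m) (R := R)
      (by simpa using (le_max_right _ _).trans_lt hR) (h1.mono (hs.trans subset_closure))
  · exact not_hasLogOn_sphere (c := 0) (q := y) (R := R)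
      (by simpa using (le_max_left _ _).trans_lt hR) (h2.mono hs)

section Components

variable {J : Set ℂ}

lemma isOpen_component (hJ : IsClosed J) (y : ℂ) : IsOpen (connectedComponentIn Jᶜ y) :=
  hJ.isOpen_compl.connectedComponentIn

lemma frontier_component_subset (hJ : IsClosed J) (y : ℂ) :
    frontier (connectedComponentIn Jᶜ y) ⊆ J := by
  intro z hz
  by_contra hzJ
  rw [(isOpen_component hJ y).frontier_eq] at hz
  have h1 : (connectedComponentIn Jᶜ z ∩ connectedComponentIn Jᶜ y).Nonempty :=
    mem_closure_iff.1 hz.1 _ (isOpen_component hJ z) (mem_connectedComponentIn hzJ)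
  obtain ⟨w, hw1, hw2⟩ := h1
  apply hz.2
  rw [connectedComponentIn_eq hw2, ← connectedComponentIn_eq hw1]
  exact mem_connectedComponentIn hzJ

lemma subset_component {T : Set ℂ} {y : ℂ} (hT : IsPreconnected T) (hTJ : T ⊆ Jᶜ)
    (h : (T ∩ connectedComponentIn Jᶜ y).Nonempty) : T ⊆ connectedComponentIn Jᶜ y := by
  obtain ⟨w, hwT, hw⟩ := h
  rw [connectedComponentIn_eq hw]
  exact hT.subset_connectedComponentIn hwT hTJ

end Components


section Clopen

/-- In a compact Hausdorff space, closed sets not joined by a component are separated by a clopen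
set. -/
lemma exists_isClopen_of_disjoint_component {Y : Type*} [TopologicalSpace Y] [T2Space Y]
    [CompactSpace Y] {A B : Set Y} (hA : IsClosed A) (hB : IsClosed B)
    (h : ∀ x ∈ A, ∀ b ∈ B, b ∉ connectedComponent x) :
    ∃ V, IsClopen V ∧ A ⊆ V ∧ Disjoint V B := by
  have key : ∀ x ∈ A, ∃ V, IsClopen V ∧ x ∈ V ∧ Disjoint V B := by
    intro x hx
    refine hB.isCompact.induction_on (p := fun s => ∃ V, IsClopen V ∧ x ∈ V ∧ Disjoint V s) ?_ ?_ ?_ ?_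
    · exact ⟨univ, isClopen_univ, mem_univ _, disjoint_empty _⟩
    · rintro s t hst ⟨V, h1, h2, h3⟩
      exact ⟨V, h1, h2, h3.mono_right hst⟩
    · rintro s t ⟨V, h1, h2, h3⟩ ⟨W, g1, g2, g3⟩
      exact ⟨V ∩ W, h1.inter g1, ⟨h2, g2⟩, disjoint_union_right.2
        ⟨h3.mono_left inter_subset_left, g3.mono_left inter_subset_right⟩⟩
    · intro b hb
      have := h x hx b hb
      rw [connectedComponent_eq_iInter_isClopen] at this
      simp only [mem_iInter, not_forall] at this
      obtain ⟨⟨V, hV, hxV⟩, hbV⟩ := this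
      exact ⟨Vᶜ, mem_nhdsWithin_of_mem_nhds (hV.compl.isOpen.mem_nhds hbV), V, hV, hxV,
        disjoint_compl_right⟩
  refine hA.isCompact.induction_on (p := fun s => ∃ V, IsClopen V ∧ s ⊆ V ∧ Disjoint V B) ?_ ?_ ?_ ?_
  · exact ⟨∅, isClopen_empty, Subset.rfl, empty_disjoint _⟩
  · rintro s t hst ⟨V, h1, h2, h3⟩
    exact ⟨V, h1, hst.trans h2, h3⟩
  · rintro s t ⟨V, h1, h2, h3⟩ ⟨W, g1, g2, g3⟩
    exact ⟨V ∪ W, h1.union g1, union_subset_union h2 g2, disjoint_union_left.2 ⟨h3, g3⟩⟩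
  · intro x hx
    obtain ⟨V, h1, h2, h3⟩ := key x hx
    exact ⟨V, mem_nhdsWithin_of_mem_nhds (h1.isOpen.mem_nhds h2), V, h1, Subset.rfl, h3⟩

/-- If no continuum in the compact set `Z` joins the closed sets `A` and `B`, then `Z` splits. -/
lemma exists_compact_separation {Z A B : Set ℂ} (hZ : IsCompact Z) (hA : IsClosed A)
    (hB : IsClosed B)
    (h : ∀ H : Set ℂ, IsCompact H → IsPreconnected H → H ⊆ Z → (H ∩ A).Nonempty →
      ¬ (H ∩ B).Nonempty) :
    ∃ Z₁ Z₂, IsCompact Z₁ ∧ IsCompact Z₂ ∧ Z = Z₁ ∪ Z₂ ∧ Disjoint Z₁ Z₂ ∧ Disjoint Z₁ B ∧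
      Disjoint Z₂ A := by
  have : CompactSpace Z := isCompact_iff_compactSpace.1 hZ
  obtain ⟨V, hV, hAV, hVB⟩ := exists_isClopen_of_disjoint_component (Y := Z)
    (hA.preimage continuous_subtype_val) (hB.preimage continuous_subtype_val) (by
      intro x hx b hb hbx
      refine h (Subtype.val '' connectedComponent x)
        (isClosed_connectedComponent.isCompact.image continuous_subtype_val)
        (isPreconnected_connectedComponent.image _ continuous_subtype_val.continuousOn)
        (Subtype.coe_image_subset _ _) ⟨x, ⟨x, mem_connectedComponent, rfl⟩, hx⟩
        ⟨b, ⟨b, hbx, rfl⟩, hb⟩)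
  refine ⟨Subtype.val '' V, Subtype.val '' Vᶜ, hV.isClosed.isCompact.image continuous_subtype_val,
    hV.compl.isClosed.isCompact.image continuous_subtype_val, ?_, ?_, ?_, ?_⟩
  · rw [← image_union, union_compl_self, image_univ, Subtype.range_coe]
  · exact (disjoint_image_iff Subtype.val_injective).2 disjoint_compl_right
  · rw [disjoint_left]
    rintro _ ⟨x, hx, rfl⟩ hxB
    exact disjoint_left.1 hVB hx hxB
  · rw [disjoint_left]
    rintro _ ⟨x, hx, rfl⟩ hxA
    exact hx (hAV hxA)

end Clopen

section Slit

open Complex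

/-- The Möbius map `(ζ - iε) / (ζ + iε)` avoids the slit outside the closed disc of radius `ε`. -/
lemma moebius_mem_slitPlane {ε : ℝ} (hε : 0 < ε) {ζ : ℂ} (hζ : ε < ‖ζ‖) :
    (ζ - I * ε) / (ζ + I * ε) ∈ slitPlane := by
  have hne : ζ + I * ε ≠ 0 := fun h => by
    have : ζ = -(I * ε) := eq_neg_of_add_eq_zero_left h
    rw [this, norm_neg, norm_mul, norm_I, one_mul, norm_real, Real.norm_of_nonneg hε.le] at hζ
    exact lt_irrefl _ hζ
  by_contra hcon
  rw [mem_slitPlane_iff_not_le_zero, not_not] at hcon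
  obtain ⟨c, hc, hcz⟩ : ∃ c : ℝ, 0 ≤ c ∧ (ζ - I * ε) / (ζ + I * ε) = -c := by
    rw [Complex.le_def] at hcon
    refine ⟨-((ζ - I * ε) / (ζ + I * ε)).re, by simpa using hcon.1, ?_⟩
    apply Complex.ext
    · simp
    · simpa using hcon.2
  rw [div_eq_iff hne] at hcz
  have h1 : ζ * ((1 + c : ℝ) : ℂ) = I * ((ε * (1 - c) : ℝ) : ℂ) := by
    push_cast; linear_combination hcz
  have h2 := congrArg norm h1
  rw [norm_mul, norm_mul, norm_I, norm_real, norm_real, one_mul, Real.norm_of_nonneg (by linarith),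
    Real.norm_eq_abs, abs_mul, abs_of_pos hε] at h2
  have h3 : |1 - c| ≤ 1 + c := abs_le.2 ⟨by linarith, by linarith⟩
  nlinarith [norm_nonneg ζ]

/-- The continuous logarithm of the Möbius map along the real line. -/
noncomputable def realLog (ε : ℝ) (ζ : ℂ) : ℂ :=
  log (ε + I * ζ) - log (ε - I * ζ) + Real.pi * I

lemma realLog_mem {ε : ℝ} (hε : 0 < ε) (x : ℝ) :
    (ε + I * (x : ℂ)) ∈ slitPlane ∧ (ε - I * (x : ℂ)) ∈ slitPlane :=
  ⟨Or.inl (by simpa using hε), Or.inl (by simpa using hε)⟩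

lemma exp_realLog {ε : ℝ} (hε : 0 < ε) (x : ℝ) :
    exp (realLog ε x) = ((x : ℂ) - I * ε) / (x + I * ε) := by
  obtain ⟨h1, h2⟩ := realLog_mem hε x
  have h1 := slitPlane_ne_zero h1
  have h2 := slitPlane_ne_zero h2
  rw [realLog, exp_add, exp_sub, exp_log h1, exp_log h2, exp_pi_mul_I]
  have h3 : (x : ℂ) + I * ε ≠ 0 := by
    have : (x : ℂ) + I * ε = I * (ε - I * x) := by linear_combination (x : ℂ) * I_sq
    rw [this]; exact mul_ne_zero I_ne_zero h2
  rw [div_mul_eq_mul_div, div_eq_div_iff h2 h3]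
  linear_combination (-2 * x * ε : ℂ) * I_sq

lemma realLog_im {ε : ℝ} (hε : 0 < ε) (x : ℝ) :
    (realLog ε x).im = 2 * arg (ε + I * x) + Real.pi := by
  have h : (ε - I * (x : ℂ)) = (starRingEnd ℂ) (ε + I * x) := by simp [sub_eq_add_neg]
  have h2 := slitPlane_arg_ne_pi (realLog_mem hε x).1
  rw [realLog, h]
  simp only [add_im, sub_im, log_im, arg_conj, if_neg h2]
  simp
  ring

lemma arg_bound {ε : ℝ} (hε : 0 < ε) (x : ℝ) :
    |arg (ε + I * x)| < Real.pi / 2 := by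
  rw [abs_arg_lt_pi_div_two_iff]; left; simpa using hε

lemma realLog_of_neg {ε : ℝ} (hε : 0 < ε) {x : ℝ} (hx : x < 0) :
    realLog ε x = log (((x : ℂ) - I * ε) / (x + I * ε)) := by
  have h1 := abs_lt.1 (arg_bound hε x)
  have h2 : arg (ε + I * x) < 0 := by rw [arg_neg_iff]; simpa using hx
  rw [← exp_realLog hε, log_exp]
  · rw [realLog_im hε]; linarith
  · rw [realLog_im hε]; linarith

lemma realLog_of_pos {ε : ℝ} (hε : 0 < ε) {x : ℝ} (hx : 0 < x) :
    realLog ε x = log (((x : ℂ) - I * ε) / (x + I * ε)) + 2 * Real.pi * I := by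
  have h1 := abs_lt.1 (arg_bound hε x)
  have h2 : 0 ≤ arg (ε + I * x) := by rw [arg_nonneg_iff]; simpa using hx.le
  have h3 : arg (ε + I * x) ≠ 0 := by
    rw [Ne, arg_eq_zero_iff]; simp [hx.ne']
  have h4 : 0 < arg (ε + I * x) := lt_of_le_of_ne h2 h3.symm
  have h5 : exp (realLog ε x - 2 * Real.pi * I) = ((x : ℂ) - I * ε) / (x + I * ε) := by
    rw [exp_sub, exp_realLog hε, exp_two_pi_mul_I, div_one]
  have h6 : (realLog ε x - 2 * Real.pi * I).im = (realLog ε x).im - 2 * Real.pi := by simp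
  rw [← h5, log_exp]
  · ring
  · rw [h6, realLog_im hε]; linarith
  · rw [h6, realLog_im hε]; linarith

end Slit


open Complex in
/-- A crosscut `segment d u ∪ Δ` together with a continuum `Γ` cannot be distinguished by a
function with opposite arguments along them. -/
lemma crosscut_no_phase {d u : ℂ} {Δ Γ O : Set ℂ} {h : ℂ → ℝ} {ψ : ℂ → ℂ} {r : ℝ}
    (hdu : d ≠ u) (hΔ : IsCompact Δ) (hΔc : IsPreconnected Δ) (huΔ : u ∈ Δ) (hdΔ : d ∉ Δ)
    (hΓ : IsCompact Γ) (hΓc : IsPreconnected Γ) (hdΓ : d ∈ Γ)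
    (hball : Disjoint (Metric.ball u (dist u d)) Γ) (hΔΓ : (Δ ∩ Γ).Nonempty)
    (hO : IsOpen O) (hOc : IsPreconnected O)
    (hOJ : Disjoint O (segment ℝ d u ∪ Δ ∪ Γ)) (hfr : frontier O ⊆ segment ℝ d u ∪ Δ ∪ Γ)
    (hh : Continuous h) (hψ : ContinuousOn ψ Oᶜ) (hψ0 : ∀ z ∈ Oᶜ, ψ z ≠ 0)
    (hψγ : ∀ z ∈ segment ℝ d u ∪ Δ, ψ z = exp (I * Real.pi * h z))
    (hψΓ : ∀ z ∈ Γ, ψ z = exp (-(I * Real.pi * h z)))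
    (hψr : ∀ z ∈ Oᶜ, r ≤ ‖z‖ → ψ z = 1) (hhd : h d = 1) (hhΔΓ : ∀ z ∈ Δ ∩ Γ, h z = 0) : False := by
  set v := u - d with hv
  have hv0 : v ≠ 0 := sub_ne_zero.2 hdu.symm
  have hvn : 0 < ‖v‖ := norm_pos_iff.2 hv0
  have hρ : dist u d = ‖v‖ := by rw [dist_eq_norm]
  obtain ⟨η, hη, hηΔ⟩ := Metric.isOpen_iff.1 hΔ.isClosed.isOpen_compl d hdΔ
  obtain ⟨t, ht0, ht1, htη⟩ : ∃ t : ℝ, 0 < t ∧ t < 1 / 2 ∧ 2 * t * ‖v‖ < η := by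
    refine ⟨min (1 / 4) (η / (4 * ‖v‖)), by positivity, ?_, ?_⟩
    · exact (min_le_left _ _).trans_lt (by norm_num)
    · have : min (1 / 4) (η / (4 * ‖v‖)) * (4 * ‖v‖) ≤ η := by
        rw [← le_div_iff₀ (by positivity)]; exact min_le_right _ _
      nlinarith
  set ζ : ℂ → ℂ := fun z => (z - d) / v - t with hζ
  have hζc : Continuous ζ := by fun_prop
  have hz_eq : ∀ z, z = d + (ζ z + t) * v := fun z => by simp only [hζ]; field_simp; ring
  have hfarΔ : ∀ z ∈ Δ, t ≤ ‖ζ z‖ := by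
    intro z hz
    by_contra! hlt
    refine hηΔ ?_ hz
    rw [Metric.mem_ball, dist_eq_norm]
    have h1 : z - d = (ζ z + t) * v := by linear_combination hz_eq z
    rw [h1, norm_mul]
    have h2 : ‖ζ z + t‖ ≤ 2 * t := (norm_add_le _ _).trans (by
      rw [norm_real, Real.norm_of_nonneg ht0.le]; linarith)
    nlinarith
  have hfarΓ : ∀ z ∈ Γ, t ≤ ‖ζ z‖ := by
    intro z hz
    by_contra! hlt
    refine disjoint_left.1 hball ?_ hz
    rw [Metric.mem_ball, hρ, dist_eq_norm]
    have h1 : z - u = (ζ z + ((t - 1 : ℝ) : ℂ)) * v := by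
      push_cast; linear_combination hz_eq z
    rw [h1, norm_mul]
    have h2 : ‖ζ z + ((t - 1 : ℝ) : ℂ)‖ < 1 := (norm_add_le _ _).trans_lt (by
      rw [norm_real, Real.norm_eq_abs, abs_of_neg (by linarith)]; linarith)
    nlinarith
  have hseg : ∀ z ∈ segment ℝ d u, ∃ x : ℝ, ζ z = x ∧ -t ≤ x ∧ x ≤ 1 - t := by
    intro z hz
    rw [segment_eq_image'] at hz
    obtain ⟨s, hs, rfl⟩ := hz
    refine ⟨s - t, ?_, by linarith [hs.1], by linarith [hs.2]⟩
    simp only [hζ, ← hv, real_smul]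
    push_cast
    field_simp
    ring
  have hsegΓ : ∀ z ∈ segment ℝ d u, z ∈ Γ → z = d := by
    intro z hz hzΓ
    obtain ⟨x, hx, hx1, hx2⟩ := hseg z hz
    have h3 : ‖z - u‖ = |x + t - 1| * ‖v‖ := by
      have h1 : z - u = ((x + t - 1 : ℝ) : ℂ) * v := by
        push_cast; rw [← hx]; linear_combination hz_eq z
      rw [h1, norm_mul, norm_real, Real.norm_eq_abs]
    have h4 : ¬ ‖z - u‖ < ‖v‖ := fun hlt =>
      disjoint_left.1 hball (by rwa [Metric.mem_ball, hρ, dist_eq_norm]) hzΓ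
    have h5 : x = - t := by
      by_contra hne
      apply h4
      rw [h3, abs_of_nonpos (by linarith)]
      have : -t < x := lt_of_le_of_ne hx1 (Ne.symm hne)
      nlinarith
    rw [hz_eq z, hx, h5]; push_cast; ring
  have hsegΔ : ∀ z ∈ segment ℝ d u, z ∈ Δ → ∃ x : ℝ, ζ z = x ∧ 0 < x := by
    intro z hz hzΔ
    obtain ⟨x, hx, hx1, hx2⟩ := hseg z hz
    refine ⟨x, hx, ?_⟩
    by_contra! hneg
    refine hηΔ ?_ hzΔ
    rw [Metric.mem_ball, dist_eq_norm]
    have h1 : z - d = ((x + t : ℝ) : ℂ) * v := by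
      push_cast; rw [← hx]; linear_combination hz_eq z
    rw [h1, norm_mul, norm_real, Real.norm_of_nonneg (by linarith)]
    nlinarith
  set ε : ℝ := t / 2 with hε
  have hε0 : 0 < ε := by positivity
  set q₁ := d + (t + I * ε) * v with hq₁
  set q₂ := d + (t - I * ε) * v with hq₂
  have hF : ∀ z, (z - q₁) / (z - q₂) = (ζ z - I * ε) / (ζ z + I * ε) := by
    intro z
    have h1 : z - q₁ = (ζ z - I * ε) * v := by rw [hq₁]; linear_combination hz_eq z
    have h2 : z - q₂ = (ζ z + I * ε) * v := by rw [hq₂]; linear_combination hz_eq z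
    rw [h1, h2, mul_div_mul_right _ _ hv0]
  set F : ℂ → ℂ := fun z => (ζ z - I * ε) / (ζ z + I * ε) with hFdef
  have hslit : ∀ z, t ≤ ‖ζ z‖ → F z ∈ slitPlane := fun z hz =>
    moebius_mem_slitPlane hε0 (by rw [hε]; linarith)
  set γ := segment ℝ d u ∪ Δ with hγ
  set J := γ ∪ Γ with hJ
  have hsegcl : IsClosed (segment ℝ d u) := by
    rw [segment_eq_image']
    exact (isCompact_Icc.image (by fun_prop)).isClosed
  have hJcomp : IsCompact J := by
    refine IsCompact.union (IsCompact.union ?_ hΔ) hΓ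
    rw [segment_eq_image']
    exact isCompact_Icc.image (by fun_prop)
  have hq₁ζ : ζ q₁ = I * ε := by simp only [hζ, hq₁]; field_simp; ring
  have hq₂ζ : ζ q₂ = -(I * ε) := by simp only [hζ, hq₂]; field_simp; ring
  have hqJ : ∀ q, ‖ζ q‖ = ε → (ζ q).im ≠ 0 → q ∉ J := by
    rintro q hq him ((hqs | hqΔ) | hqΓ)
    · obtain ⟨x, hx, -, -⟩ := hseg q hqs
      rw [hx, ofReal_im] at him; exact him rfl
    · have := hfarΔ q hqΔ; linarith
    · have := hfarΓ q hqΓ; linarith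
  have hq₁J : q₁ ∉ J := hqJ _ (by rw [hq₁ζ]; simp [abs_of_pos hε0]) (by
    rw [hq₁ζ]; simp [hε0.ne'])
  have hq₂J : q₂ ∉ J := hqJ _ (by rw [hq₂ζ]; simp [abs_of_pos hε0]) (by
    rw [hq₂ζ]; simp [hε0.ne'])
  have hne : ∀ (q : ℂ) (s : Set ℂ), q ∉ s → ∀ z ∈ s, z - q ≠ 0 := fun q s hq z hz h =>
    hq (by rwa [← sub_eq_zero.1 h])
  -- logarithms of `F` along the pieces
  have hlogF : ∀ s : Set ℂ, (∀ z ∈ s, t ≤ ‖ζ z‖) → IsLogOn (fun z => log (F z)) F s := by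
    intro s hs
    refine ⟨ContinuousOn.clog ?_ fun z hz => hslit z (hs z hz), fun z hz =>
      exp_log (slitPlane_ne_zero (hslit z (hs z hz)))⟩
    refine ContinuousOn.div (by fun_prop) (by fun_prop) fun z hz h0 => ?_
    have h1 := hs z hz
    rw [eq_neg_of_add_eq_zero_left h0] at h1
    simp only [norm_neg, norm_mul, norm_I, one_mul, norm_real, Real.norm_of_nonneg hε0.le] at h1
    linarith
  have hlogseg : IsLogOn (fun z => realLog ε (ζ z)) F (segment ℝ d u) := by
    constructor
    · unfold realLog
      refine ContinuousOn.add (ContinuousOn.sub (ContinuousOn.clog (by fun_prop) ?_)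
        (ContinuousOn.clog (by fun_prop) ?_)) continuousOn_const
      · intro z hz; obtain ⟨x, hx, -⟩ := hseg z hz
        rw [hx]; exact (realLog_mem hε0 x).1
      · intro z hz; obtain ⟨x, hx, -⟩ := hseg z hz
        rw [hx]; exact (realLog_mem hε0 x).2
    · intro z hz
      obtain ⟨x, hx, -⟩ := hseg z hz
      simp only [hFdef, hx]; exact exp_realLog hε0 x
  have hd_seg : d ∈ segment ℝ d u := left_mem_segment ℝ d u
  have hu_seg : u ∈ segment ℝ d u := right_mem_segment ℝ d u
  have hat_d : realLog ε (ζ d) = log (F d) := by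
    have : ζ d = ((-t : ℝ) : ℂ) := by simp [hζ]
    simp only [hFdef, this]; exact realLog_of_neg hε0 (by linarith)
  have hat_Δ : ∀ z ∈ segment ℝ d u, z ∈ Δ → realLog ε (ζ z) = log (F z) + 2 * Real.pi * I := by
    intro z hz hzΔ
    obtain ⟨x, hx, hx0⟩ := hsegΔ z hz hzΔ
    simp only [hFdef, hx]; exact realLog_of_pos hε0 hx0
  classical
  obtain ⟨g, hg⟩ : HasLogOn (fun z => F z * ψ z) J := by
    have hγlog : HasLogOn (fun z => F z) γ ∧ ∃ G : ℂ → ℂ, IsLogOn G F γ ∧ G d = log (F d) ∧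
        ∀ z ∈ Δ, G z = log (F z) + 2 * Real.pi * I := by
      set G : ℂ → ℂ := fun z => if z ∈ Δ then log (F z) + 2 * Real.pi * I else realLog ε (ζ z)
      have hGΔ : ∀ z ∈ Δ, G z = log (F z) + 2 * Real.pi * I := fun z hz => if_pos hz
      have hGs : ∀ z ∈ segment ℝ d u, G z = realLog ε (ζ z) := by
        intro z hz
        by_cases hzΔ : z ∈ Δ
        · rw [hGΔ z hzΔ, hat_Δ z hz hzΔ]
        · exact if_neg hzΔ
      have hGlog : IsLogOn G F γ := by
        constructor
        · refine ContinuousOn.union_of_isClosed (hlogseg.1.congr hGs) ?_ hsegcl hΔ.isClosed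
          exact ((hlogF Δ hfarΔ).1.add continuousOn_const).congr hGΔ
        · rintro z (hz | hz)
          · rw [hGs z hz]; exact hlogseg.2 z hz
          · rw [hGΔ z hz, exp_add, (hlogF Δ hfarΔ).2 z hz, exp_two_pi_mul_I, mul_one]
      exact ⟨⟨G, hGlog⟩, G, hGlog, (hGs d hd_seg).trans hat_d, hGΔ⟩
    obtain ⟨-, G, hG, hGd, hGΔ⟩ := hγlog
    have hΓlog := hlogF Γ hfarΓ
    set g : ℂ → ℂ := fun z => if z ∈ Γ then log (F z) - I * Real.pi * h z
      else G z + I * Real.pi * h z - 2 * Real.pi * I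
    have hgΓ : ∀ z ∈ Γ, g z = log (F z) - I * Real.pi * h z := fun z hz => if_pos hz
    have hgγ : ∀ z ∈ γ, g z = G z + I * Real.pi * h z - 2 * Real.pi * I := by
      intro z hz
      by_cases hzΓ : z ∈ Γ
      · rw [hgΓ z hzΓ]
        rcases hz with hz | hz
        · rw [hsegΓ z hz hzΓ, hGd, hhd]; push_cast; ring
        · rw [hGΔ z hz, hhΔΓ z ⟨hz, hzΓ⟩]; push_cast; ring
      · exact if_neg hzΓ
    refine ⟨g, ?_, ?_⟩
    · refine ContinuousOn.union_of_isClosed ?_ ?_ (hsegcl.union hΔ.isClosed) hΓ.isClosed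
      · exact ((hG.1.add (by fun_prop)).sub continuousOn_const).congr hgγ
      · exact (hΓlog.1.sub (by fun_prop)).congr hgΓ
    · rintro z (hz | hz)
      · rw [hgγ z hz, exp_sub, exp_add, hG.2 z hz, exp_two_pi_mul_I, div_one, ← hψγ z hz]
      · rw [hgΓ z hz, sub_eq_add_neg, exp_add, hΓlog.2 z hz, ← hψΓ z hz]
  have hJO : J ⊆ Oᶜ := fun z hz hzO => disjoint_left.1 hOJ hzO hz
  have hclO : ∀ q, q ∉ O → q ∉ J → q ∉ closure O := fun q hq hqJ h =>
    hqJ (hfr (by rw [hO.frontier_eq]; exact ⟨h, hq⟩))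
  obtain ⟨R, hR, hsph⟩ := exists_sphere_subset hO hJcomp.isBounded hfr (max r (max ‖q₁‖ ‖q₂‖))
  have hRr : r < R := (le_max_left _ _).trans_lt hR
  have hR1 : ‖q₁‖ < R := ((le_max_left _ _).trans (le_max_right _ _)).trans_lt hR
  have hR2 : ‖q₂‖ < R := ((le_max_right _ _).trans (le_max_right _ _)).trans_lt hR
  have hsphψ : Metric.sphere 0 R ⊆ Oᶜ → ∀ z ∈ Metric.sphere (0 : ℂ) R, ψ z = 1 := by
    intro hs z hz
    refine hψr z (hs hz) ?_
    rw [mem_sphere_zero_iff_norm] at hz; linarith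
  have hNL1 := not_hasLogOn_sphere (c := 0) (q := q₁) (R := R) (by simpa using hR1)
  have hNL2 := not_hasLogOn_sphere (c := 0) (q := q₂) (R := R) (by simpa using hR2)
  have hgF : ∀ z ∈ J, exp (g z) = (z - q₁) / (z - q₂) * ψ z := fun z hz => by
    rw [hg.2 z hz, hF]
  by_cases h1 : q₁ ∈ O <;> by_cases h2 : q₂ ∈ O
  · obtain ⟨l, hl⟩ := (hasLogOn_div_of_isPreconnected hJcomp.isClosed hOc
      (fun z hz hzJ => hJO hzJ hz) h1 h2).congr (G := F) (fun z _ => hF z)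
    have e1 := (hl.mono (t := segment ℝ d u) fun z hz => Or.inl (Or.inl hz)).sub_eq_sub hlogseg
      (convex_segment d u).isPreconnected hd_seg hu_seg
    obtain ⟨w, hwΔ, hwΓ⟩ := hΔΓ
    have hcon : IsPreconnected (Δ ∪ Γ) := hΔc.union w hwΔ hwΓ hΓc
    have e2 := (hl.mono (t := Δ ∪ Γ) (by
      rintro z (hz | hz)
      · exact Or.inl (Or.inr hz)
      · exact Or.inr hz)).sub_eq_sub (hlogF (Δ ∪ Γ) (by
      rintro z (hz | hz)
      · exact hfarΔ z hz
      · exact hfarΓ z hz)) hcon (Or.inr hdΓ : d ∈ Δ ∪ Γ) (Or.inl huΔ)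
    rw [hat_d, hat_Δ u hu_seg huΔ, e2] at e1
    have : (2 * Real.pi * I : ℂ) = 0 := by linear_combination e1
    exact two_pi_I_ne_zero this
  · obtain ⟨g1, g2⟩ := hasLogOn_of_glue hO hJcomp.isClosed hfr (a := fun z => z - q₂)
      (b := fun z => (z - q₁) * ψ z) (g := fun z => - g z) (by fun_prop)
      (hne q₂ _ (hclO q₂ h2 hq₂J)) (ContinuousOn.mul (by fun_prop) hψ)
      (fun z hz => mul_ne_zero (hne q₁ _ (not_not.2 h1) z hz) (hψ0 z hz)) hg.1.neg
      (fun z hz => by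
        have := hne q₁ _ hq₁J z hz
        have := hne q₂ _ hq₂J z hz
        have := hψ0 z (hJO hz)
        rw [exp_neg, hgF z hz]; field_simp)
    rcases hsph with hs | hs
    · exact hNL2 (g1.mono (hs.trans subset_closure))
    · exact hNL1 ((g2.mono hs).congr fun z hz => by rw [hsphψ hs z hz, mul_one])
  · obtain ⟨g1, g2⟩ := hasLogOn_of_glue hO hJcomp.isClosed hfr (a := fun z => z - q₁)
      (b := fun z => (z - q₂) * (ψ z)⁻¹) (g := g) (by fun_prop)
      (hne q₁ _ (hclO q₁ h1 hq₁J)) (ContinuousOn.mul (by fun_prop) (hψ.inv₀ hψ0))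
      (fun z hz => mul_ne_zero (hne q₂ _ (not_not.2 h2) z hz) (inv_ne_zero (hψ0 z hz))) hg.1
      (fun z hz => by
        have := hne q₁ _ hq₁J z hz
        have := hne q₂ _ hq₂J z hz
        have := hψ0 z (hJO hz)
        rw [hgF z hz]; field_simp)
    rcases hsph with hs | hs
    · exact hNL1 (g1.mono (hs.trans subset_closure))
    · exact hNL2 ((g2.mono hs).congr fun z hz => by rw [hsphψ hs z hz, inv_one, mul_one])
  · obtain ⟨-, g2⟩ := hasLogOn_of_glue hO hJcomp.isClosed hfr
      (a := fun z => (z - q₁) / (z - q₂))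
      (b := fun z => (ψ z)⁻¹) (g := g)
      (ContinuousOn.div (by fun_prop) (by fun_prop) (hne q₂ _ (hclO q₂ h2 hq₂J)))
      (fun z hz => div_ne_zero (hne q₁ _ (hclO q₁ h1 hq₁J) z hz)
        (hne q₂ _ (hclO q₂ h2 hq₂J) z hz)) (hψ.inv₀ hψ0)
      (fun z hz => inv_ne_zero (hψ0 z hz)) hg.1
      (fun z hz => by
        have := hψ0 z (hJO hz)
        rw [hgF z hz]; field_simp)
    obtain ⟨l, hl⟩ := g2.mono hJO
    obtain ⟨w, hwΔ, hwΓ⟩ := hΔΓ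
    have k1 : IsLogOn (fun z => -(I * Real.pi * h z)) (fun z => (ψ z)⁻¹) γ :=
      ⟨by fun_prop, fun z hz => by simp only [hψγ z hz, exp_neg]⟩
    have k2 : IsLogOn (fun z => (I * Real.pi * h z)) (fun z => (ψ z)⁻¹) Γ :=
      ⟨by fun_prop, fun z hz => by simp only [hψΓ z hz, exp_neg, inv_inv]⟩
    have hγc : IsPreconnected γ :=
      (convex_segment d u).isPreconnected.union u hu_seg huΔ hΔc
    have e1 := (hl.mono (t := γ) fun z hz => Or.inl hz).sub_eq_sub k1 hγc (Or.inl hd_seg)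
      (Or.inr hwΔ)
    have e2 := (hl.mono (t := Γ) fun z hz => Or.inr hz).sub_eq_sub k2 hΓc hdΓ hwΓ
    simp only [hhd, hhΔΓ w ⟨hwΔ, hwΓ⟩] at e1 e2
    have : (2 * Real.pi * I : ℂ) = 0 := by push_cast at e1 e2; linear_combination e1 - e2
    exact two_pi_I_ne_zero this


open Complex in
/-- A complementary domain of `segment d u ∪ Δ ∪ Γ` is linked with the two pieces outside of any
pair of disjoint open sets separating the two intersection points. -/
lemma exists_connector {d u : ℂ} {Δ Γ O O₁ O₂ : Set ℂ} {r : ℝ}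
    (hdu : d ≠ u) (hΔ : IsCompact Δ) (hΔc : IsPreconnected Δ) (huΔ : u ∈ Δ) (hdΔ : d ∉ Δ)
    (hΓ : IsCompact Γ) (hΓc : IsPreconnected Γ) (hdΓ : d ∈ Γ)
    (hball : Disjoint (Metric.ball u (dist u d)) Γ) (hΔΓ : (Δ ∩ Γ).Nonempty)
    (hO : IsOpen O) (hOc : IsPreconnected O)
    (hOJ : Disjoint O (segment ℝ d u ∪ Δ ∪ Γ)) (hfr : frontier O ⊆ segment ℝ d u ∪ Δ ∪ Γ)
    (hO₁ : IsOpen O₁) (hO₂ : IsOpen O₂) (hdisj : Disjoint O₁ O₂)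
    (hr : ∀ z : ℂ, r < ‖z‖ → z ∈ O₁) (hΔΓO : Δ ∩ Γ ⊆ O₁) (hdO : d ∈ O₂) :
    ∃ H, IsCompact H ∧ IsPreconnected H ∧ H ⊆ Oᶜ \ (O₁ ∪ O₂) ∧
      (H ∩ (segment ℝ d u ∪ Δ)).Nonempty ∧ (H ∩ Γ).Nonempty := by
  by_contra hcon
  have hsegcl : IsClosed (segment ℝ d u) := by
    rw [segment_eq_image']
    exact (isCompact_Icc.image (by fun_prop)).isClosed
  set γ := segment ℝ d u ∪ Δ with hγ
  have hγcl : IsClosed γ := hsegcl.union hΔ.isClosed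
  set Z := Oᶜ \ (O₁ ∪ O₂) with hZ
  have hZc : IsCompact Z := by
    refine (isCompact_closedBall (0 : ℂ) r).of_isClosed_subset
      (hO.isClosed_compl.sdiff (hO₁.union hO₂)) fun z hz => ?_
    rw [mem_closedBall_zero_iff]
    by_contra! h
    exact hz.2 (Or.inl (hr z h))
  obtain ⟨Z₁, Z₂, hZ₁, hZ₂, hZZ, hZd, hZΓ, hZγ⟩ := exists_compact_separation hZc hγcl hΓ.isClosed
    (fun H h1 h2 h3 h4 h5 => hcon ⟨H, h1, h2, h3, h4, h5⟩)
  have hdγ : d ∈ γ := Or.inl (left_mem_segment ℝ d u)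
  set s : ℂ → ℝ := fun z => Metric.infDist z (Z₂ ∪ Γ) - Metric.infDist z (Z₁ ∪ γ) with hs
  have hsc : Continuous s := (Metric.continuous_infDist_pt _).sub (Metric.continuous_infDist_pt _)
  have hcl2 : IsClosed (Z₂ ∪ Γ) := hZ₂.isClosed.union hΓ.isClosed
  have hcl1 : IsClosed (Z₁ ∪ γ) := hZ₁.isClosed.union hγcl
  have hs1 : ∀ z ∈ Z₁ ∪ γ, 0 ≤ s z := fun z hz => by
    simp only [hs, Metric.infDist_zero_of_mem hz, sub_zero]; exact Metric.infDist_nonneg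
  have hs2 : ∀ z ∈ Z₂ ∪ Γ, s z ≤ 0 := fun z hz => by
    simp only [hs, Metric.infDist_zero_of_mem hz, zero_sub]
    exact neg_nonpos.2 Metric.infDist_nonneg
  have hsZ : ∀ z ∈ Z, s z ≠ 0 := by
    intro z hz h0
    rw [hZZ] at hz
    rcases hz with hz | hz
    · have h1 : z ∉ Z₂ ∪ Γ := by
        rintro (h | h)
        · exact disjoint_left.1 hZd hz h
        · exact disjoint_left.1 hZΓ hz h
      rw [hcl2.notMem_iff_infDist_pos ⟨d, Or.inr hdΓ⟩] at h1
      simp only [hs, Metric.infDist_zero_of_mem (show z ∈ Z₁ ∪ γ from Or.inl hz), sub_zero] at h0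
      exact h1.ne' h0
    · have h1 : z ∉ Z₁ ∪ γ := by
        rintro (h | h)
        · exact disjoint_left.1 hZd h hz
        · exact disjoint_left.1 hZγ hz h
      rw [hcl1.notMem_iff_infDist_pos ⟨d, Or.inr hdγ⟩] at h1
      simp only [hs, Metric.infDist_zero_of_mem (show z ∈ Z₂ ∪ Γ from Or.inl hz), zero_sub,
        neg_eq_zero] at h0
      exact h1.ne' h0
  have hsO : ∀ z ∈ Oᶜ, s z = 0 → z ∈ O₁ ∨ z ∈ O₂ := by
    intro z hz h0
    by_contra hno
    exact hsZ z ⟨hz, hno⟩ h0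
  have hs0cl : IsClosed (Oᶜ ∩ {z | s z = 0}) :=
    hO.isClosed_compl.inter (isClosed_eq hsc continuous_const)
  set A₀ : Set ℂ := (Oᶜ ∩ {z | s z = 0}) \ O₂ ∪ {z | r + 1 ≤ ‖z‖} with hA₀
  set A₁ : Set ℂ := (Oᶜ ∩ {z | s z = 0}) \ O₁ with hA₁
  have hA₀c : IsClosed A₀ :=
    (hs0cl.sdiff hO₂).union (isClosed_le continuous_const continuous_norm)
  have hA₁c : IsClosed A₁ := hs0cl.sdiff hO₁
  have hA : Disjoint A₀ A₁ := by
    rw [disjoint_left]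
    rintro z (hz | hz) hz1
    · rcases hsO z hz.1.1 hz.1.2 with h | h
      · exact hz1.2 h
      · exact hz.2 h
    · exact hz1.2 (hr z (by have : r + 1 ≤ ‖z‖ := hz; linarith))
  obtain ⟨hf, hh0, hh1, -⟩ := exists_continuous_zero_one_of_isClosed hA₀c hA₁c hA
  have hOJ' : ∀ z ∈ γ ∪ Γ, z ∈ Oᶜ := fun z hz hzO => disjoint_left.1 hOJ hzO hz
  classical
  set ψ : ℂ → ℂ := fun z => if 0 ≤ s z then exp (I * Real.pi * hf z)
    else exp (-(I * Real.pi * hf z)) with hψ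
  have hψpos : ∀ z ∈ Oᶜ, 0 ≤ s z → ψ z = exp (I * Real.pi * hf z) := fun z _ h => if_pos h
  have hψneg : ∀ z ∈ Oᶜ, s z ≤ 0 → ψ z = exp (-(I * Real.pi * hf z)) := by
    intro z hz h
    rcases h.lt_or_eq with h | h
    · exact if_neg (not_le.2 h)
    · rw [hψpos z hz h.ge]
      rcases hsO z hz h with h1 | h1
      · have : hf z = 0 := hh0 (Or.inl ⟨⟨hz, h⟩, fun h2 => disjoint_left.1 hdisj h1 h2⟩)
        simp [this]
      · have : hf z = 1 := hh1 ⟨⟨hz, h⟩, fun h2 => disjoint_left.1 hdisj h2 h1⟩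
        rw [this, exp_neg, mul_comm I]; simp [exp_pi_mul_I]
  have hψc : ContinuousOn ψ Oᶜ := by
    have h1 : ContinuousOn ψ (Oᶜ ∩ {z | 0 ≤ s z}) :=
      (by fun_prop : ContinuousOn (fun z => exp (I * Real.pi * hf z)) _).congr
        fun z hz => hψpos z hz.1 hz.2
    have h2 : ContinuousOn ψ (Oᶜ ∩ {z | s z ≤ 0}) :=
      (by fun_prop : ContinuousOn (fun z => exp (-(I * Real.pi * hf z))) _).congr
        fun z hz => hψneg z hz.1 hz.2
    refine (h1.union_of_isClosed h2
      (hO.isClosed_compl.inter (isClosed_le continuous_const hsc))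
      (hO.isClosed_compl.inter (isClosed_le hsc continuous_const))).mono fun z hz => ?_
    rcases le_total 0 (s z) with h | h
    · exact Or.inl ⟨hz, h⟩
    · exact Or.inr ⟨hz, h⟩
  have hs0 : ∀ z ∈ γ, z ∈ Γ → s z = 0 := fun z h1 h2 =>
    le_antisymm (hs2 z (Or.inr h2)) (hs1 z (Or.inr h1))
  refine crosscut_no_phase (h := hf) (ψ := ψ) (r := r + 1) hdu hΔ hΔc huΔ hdΔ hΓ hΓc hdΓ hball hΔΓ
    hO hOc hOJ hfr hf.continuous hψc ?_ (fun z hz => hψpos z (hOJ' z (Or.inl hz)) (hs1 z (Or.inr hz)))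
    (fun z hz => hψneg z (hOJ' z (Or.inr hz)) (hs2 z (Or.inr hz))) ?_ ?_ ?_
  · intro z _
    simp only [hψ]
    split_ifs <;> exact exp_ne_zero _
  · intro z hz hzr
    have : hf z = 0 := hh0 (Or.inr hzr)
    simp [hψ, this]
  · exact hh1 ⟨⟨hOJ' d (Or.inl hdγ), hs0 d hdγ hdΓ⟩, fun h => disjoint_left.1 hdisj h hdO⟩
  · intro z hz
    exact hh0 (Or.inl ⟨⟨hOJ' z (Or.inr hz.2), hs0 z (Or.inr hz.1) hz.2⟩,
      fun h => disjoint_left.1 hdisj (hΔΓO hz) h⟩)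


section Paths

lemma exists_compact_preconnected_joining {U : Set ℂ} (hU : IsOpen U) (hUc : IsPreconnected U)
    {a b : ℂ} (ha : a ∈ U) (hb : b ∈ U) :
    ∃ P, IsCompact P ∧ IsPreconnected P ∧ P ⊆ U ∧ a ∈ P ∧ b ∈ P := by
  have hp : IsPathConnected U := hU.isConnected_iff_isPathConnected.1 ⟨⟨a, ha⟩, hUc⟩
  obtain ⟨f, hf⟩ := hp.joinedIn a ha b hb
  exact ⟨range f, isCompact_range f.continuous, isPreconnected_range f.continuous,
    range_subset_iff.2 hf, ⟨0, f.source⟩, ⟨1, f.target⟩⟩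

lemma exists_first_hit {α : Type*} [TopologicalSpace α] {f : ℝ → α} {J : Set α}
    (hf : ContinuousOn f (Icc 0 1)) (hJ : IsClosed J) {t₁ : ℝ} (ht₁ : t₁ ∈ Icc (0 : ℝ) 1)
    (h : f t₁ ∈ J) : ∃ t ∈ Icc (0 : ℝ) 1, f t ∈ J ∧ ∀ s, 0 ≤ s → s < t → f s ∉ J := by
  have hc : IsCompact (Icc (0 : ℝ) 1 ∩ f ⁻¹' J) :=
    isCompact_Icc.of_isClosed_subset (hf.preimage_isClosed_of_isClosed isClosed_Icc hJ)
      inter_subset_left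
  obtain ⟨t, ht, hle⟩ := hc.exists_isLeast ⟨t₁, ht₁, h⟩
  exact ⟨t, ht.1, ht.2, fun s hs hst hsJ => absurd (hle ⟨⟨hs, hst.le.trans ht.1.2⟩, hsJ⟩)
    (not_le.2 hst)⟩

/-- A point of `U` outside of a complementary domain `O` of `J` can be joined with `J` inside `U`
and outside of `O`. -/
lemma exists_compact_preconnected_hit {U J O : Set ℂ} (hU : IsOpen U) (hUc : IsPreconnected U)
    (hJ : IsClosed J) (hO : IsOpen O) (hfr : frontier O ⊆ J) {z j : ℂ} (hz : z ∈ U) (hzO : z ∉ O)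
    (hj : j ∈ U) (hjJ : j ∈ J) (hJO : Disjoint O J) :
    ∃ P, IsCompact P ∧ IsPreconnected P ∧ P ⊆ U ∧ P ⊆ Oᶜ ∧ z ∈ P ∧ (P ∩ J).Nonempty := by
  have hp : IsPathConnected U := hU.isConnected_iff_isPathConnected.1 ⟨⟨z, hz⟩, hUc⟩
  obtain ⟨f, hf⟩ := hp.joinedIn z hz j hj
  have hfc : ContinuousOn f.extend (Icc 0 1) := f.continuous_extend.continuousOn
  obtain ⟨t, ht, htJ, hlt⟩ := exists_first_hit hfc hJ (right_mem_Icc.2 zero_le_one)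
    (by rwa [f.extend_one])
  refine ⟨f.extend '' Icc 0 t, isCompact_Icc.image f.continuous_extend,
    isPreconnected_Icc.image _ f.continuous_extend.continuousOn, ?_, ?_,
    ⟨0, left_mem_Icc.2 ht.1, f.extend_zero⟩, ⟨f.extend t, ⟨t, right_mem_Icc.2 ht.1, rfl⟩, htJ⟩⟩
  · rintro _ ⟨s, hs, rfl⟩
    rw [f.extend_apply ⟨hs.1, hs.2.trans ht.2⟩]
    exact hf _
  · rintro _ ⟨s, hs, rfl⟩ hsO
    rcases hs.2.lt_or_eq with h | rfl
    · have hsub : f.extend '' Ico 0 t ⊆ O := by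
        refine (isPreconnected_Ico.image _
          f.continuous_extend.continuousOn).subset_of_closure_inter_subset hO
          ⟨_, ⟨s, ⟨hs.1, h⟩, rfl⟩, hsO⟩ ?_
        rintro _ ⟨hw, ⟨x, hx, rfl⟩⟩
        by_contra hxO
        exact hlt x hx.1 hx.2 (hfr (by rw [hO.frontier_eq]; exact ⟨hw, hxO⟩))
      apply hzO
      have := hsub ⟨0, ⟨le_rfl, hs.1.trans_lt h⟩, rfl⟩
      rwa [f.extend_zero] at this
    · exact disjoint_left.1 hJO hsO htJ

/-- Logarithms with a prescribed value at a point. -/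
lemma HasLogOn.exists_eq {α : Type*} [TopologicalSpace α] {F : α → ℂ} {s : Set α}
    (h : HasLogOn F s) {x : α} (hx : x ∈ s) {c : ℂ}
    (hc : Complex.exp c = F x) : ∃ g, IsLogOn g F s ∧ g x = c := by
  obtain ⟨g, hg⟩ := h
  refine ⟨fun z => g z + (c - g x), ⟨hg.1.add continuousOn_const, fun z hz => ?_⟩, by ring⟩
  have h0 : F x ≠ 0 := by rw [← hc]; exact Complex.exp_ne_zero _
  rw [Complex.exp_add, Complex.exp_sub, hc, hg.2 x hx, div_self h0, mul_one, hg.2 z hz]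

/-- Logarithms on compact subsets of a plane domain assemble to a logarithm on the domain. -/
lemma hasLogOn_of_compact {U : Set ℂ} (hU : IsOpen U) (hUc : IsPreconnected U) {F : ℂ → ℂ}
    (h : ∀ K ⊆ U, IsCompact K → HasLogOn F K) : HasLogOn F U := by
  rcases U.eq_empty_or_nonempty with rfl | ⟨u₀, hu₀⟩
  · exact ⟨fun _ => 0, continuousOn_empty _, fun z hz => hz.elim⟩
  obtain ⟨c, hc⟩ : ∃ c, Complex.exp c = F u₀ := by
    obtain ⟨g, hg⟩ := h {u₀} (singleton_subset_iff.2 hu₀) isCompact_singleton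
    exact ⟨g u₀, hg.2 u₀ rfl⟩
  have key : ∀ u, ∃ P g, u ∈ U → IsCompact P ∧ IsPreconnected P ∧ P ⊆ U ∧ u₀ ∈ P ∧ u ∈ P ∧
      IsLogOn g F P ∧ g u₀ = c := by
    intro u
    by_cases hu : u ∈ U
    · obtain ⟨P, h1, h2, h3, h4, h5⟩ := exists_compact_preconnected_joining hU hUc hu₀ hu
      obtain ⟨g, hg⟩ := (h P h3 h1).exists_eq h4 hc
      exact ⟨P, g, fun _ => ⟨h1, h2, h3, h4, h5, hg⟩⟩
    · exact ⟨∅, fun _ => 0, fun h => absurd h hu⟩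
  choose P g hPg using key
  have uniq : ∀ u ∈ U, ∀ K ⊆ U, IsCompact K → IsPreconnected K → u₀ ∈ K → u ∈ K →
      ∀ k, IsLogOn k F K → k u₀ = c → g u u = k u := by
    intro u hu K hKU hK hKc h0 huK k hk hkc
    obtain ⟨h1, h2, h3, h4, h5, h6, h7⟩ := hPg u hu
    obtain ⟨l, hl, hlc⟩ := (h (P u ∪ K) (union_subset h3 hKU) (h1.union hK)).exists_eq
      (Or.inl h4) hc
    rw [h6.eqOn (hl.mono subset_union_left) h2 h4 (h7.trans hlc.symm) h5,
      hk.eqOn (hl.mono subset_union_right) hKc h0 (hkc.trans hlc.symm) huK]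
  refine ⟨fun u => g u u, fun u hu => ?_, fun u hu => ?_⟩
  · obtain ⟨h1, h2, h3, h4, h5, h6, h7⟩ := hPg u hu
    obtain ⟨ε, hε, hball⟩ := Metric.nhds_basis_closedBall.mem_iff.1 (hU.mem_nhds hu)
    have hK : IsPreconnected (P u ∪ Metric.closedBall u ε) :=
      h2.union u h5 (Metric.mem_closedBall_self hε.le) (convex_closedBall u ε).isPreconnected
    have hKU := union_subset h3 hball
    have hKcp := h1.union (isCompact_closedBall u ε)
    obtain ⟨l, hl, hlc⟩ := (h _ hKU hKcp).exists_eq (Or.inl h4) hc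
    have heq : ∀ w ∈ Metric.closedBall u ε, g w w = l w := fun w hw =>
      uniq w (hball hw) _ hKU hKcp hK (Or.inl h4) (Or.inr hw) l hl hlc
    have hlc : ContinuousAt l u := (hl.1.mono subset_union_right).continuousAt
      (Metric.closedBall_mem_nhds u hε)
    exact (hlc.congr (by
      filter_upwards [Metric.closedBall_mem_nhds u hε] with w hw using (heq w hw).symm)
      ).continuousWithinAt
  · obtain ⟨h1, h2, h3, h4, h5, h6, h7⟩ := hPg u hu
    exact h6.2 u h5

end Paths

/-- A compact plane set `X` contracted along a semicontinuous family of arcs `α x` from `x` to the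
base point `p`, with a hereditarily disconnected set `E` of maximal points. -/
structure ArcFan (X E : Set ℂ) (p : ℂ) (α : ℂ → Set ℂ) : Prop where
  isCompact : IsCompact X
  base_mem : p ∈ X
  sub : E ⊆ X
  base_notMem : p ∉ E
  arc_sub : ∀ x ∈ X, α x ⊆ X
  self_mem : ∀ x ∈ X, x ∈ α x
  base_mem_arc : ∀ x ∈ X, p ∈ α x
  arc_isCompact : ∀ x ∈ X, IsCompact (α x)
  arc_isPreconnected : ∀ x ∈ X, IsPreconnected (α x)
  arc_base : α p = {p}
  trans : ∀ x ∈ X, ∀ w ∈ α x, α w ⊆ α x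
  hasLogOn : ∀ x ∈ X, ∀ F : ℂ → ℂ, ContinuousOn F (α x) → (∀ z ∈ α x, F z ≠ 0) → HasLogOn F (α x)
  diff : ∀ x ∈ X, ∀ Γ : Set ℂ, IsClosed Γ → p ∈ Γ → (∀ w ∈ α x, w ∈ Γ → α w ⊆ Γ) →
    IsPreconnected (α x \ Γ)
  usc : ∀ x ∈ X, ∀ N, IsOpen N → α x ⊆ N → ∀ᶠ x' in 𝓝[X] x, α x' ⊆ N
  max : ∀ e ∈ E, ∀ x ∈ X, e ∈ α x → x = e
  hd : ∀ S ⊆ E, IsPreconnected S → S.Subsingleton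

namespace ArcFan

variable {X E : Set ℂ} {p : ℂ} {α : ℂ → Set ℂ}

lemma isPreconnected (D : ArcFan X E p α) : IsPreconnected X := by
  refine isPreconnected_of_forall p fun x hx => ⟨α x, D.arc_sub x hx, D.base_mem_arc x hx,
    D.self_mem x hx, D.arc_isPreconnected x hx⟩

/-- Lifting logarithms along the arcs of a fan. -/
lemma lift (D : ArcFan X E p α) {W : Set ℂ} (hW : IsOpen W) {F : ℂ → ℂ} (hF : ContinuousOn F W)
    (hF0 : ∀ z ∈ W, F z ≠ 0) : HasLogOn F {x | x ∈ X ∧ α x ⊆ W} := by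
  by_cases hpW : p ∈ W
  swap
  · refine ⟨fun _ => 0, ?_, fun z hz => absurd (hz.2 (D.base_mem_arc z hz.1)) hpW⟩
    exact continuousOn_const
  have hc := Complex.exp_log (hF0 p hpW)
  set c := Complex.log (F p)
  have key : ∀ x, ∃ g, x ∈ X → α x ⊆ W → IsLogOn g F (α x) ∧ g p = c := by
    intro x
    by_cases hx : x ∈ X ∧ α x ⊆ W
    · obtain ⟨g, hg⟩ := (D.hasLogOn x hx.1 F (hF.mono hx.2) fun z hz => hF0 z (hx.2 hz)).exists_eq
        (D.base_mem_arc x hx.1) hc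
      exact ⟨g, fun _ _ => hg⟩
    · exact ⟨fun _ => 0, fun h1 h2 => absurd ⟨h1, h2⟩ hx⟩
  choose g hg using key
  refine ⟨fun x => g x x, ?_, fun x hx => (hg x hx.1 hx.2).1.2 x (D.self_mem x hx.1)⟩
  rintro x ⟨hx, hxW⟩
  obtain ⟨hgx, hgp⟩ := hg x hx hxW
  obtain ⟨G, hG⟩ := ContinuousMap.exists_restrict_eq (D.arc_isCompact x hx).isClosed
    ⟨(α x).domRestrict (g x), continuousOn_iff_continuous_domRestrict.mp hgx.1⟩
  have hGg : ∀ z ∈ α x, G z = g x z := fun z hz => DFunLike.congr_fun hG ⟨z, hz⟩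
  set Q : ℂ → ℂ := fun z => F z * Complex.exp (-G z) with hQ
  have hQc : ContinuousOn Q W := hF.mul (by fun_prop)
  set N := W ∩ Q ⁻¹' Complex.slitPlane with hN
  have hNo : IsOpen N := hQc.isOpen_inter_preimage hW Complex.isOpen_slitPlane
  have hQ1 : ∀ z ∈ α x, Q z = 1 := fun z hz => by
    simp only [hQ]
    rw [hGg z hz, Complex.exp_neg, hgx.2 z hz, mul_inv_cancel₀ (hF0 z (hxW hz))]
  have hxN : α x ⊆ N := fun z hz => ⟨hxW hz, by
    rw [mem_preimage, hQ1 z hz]; exact Complex.one_mem_slitPlane⟩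
  set L : ℂ → ℂ := fun z => G z + Complex.log (Q z) with hL
  have hLlog : IsLogOn L F N := by
    refine ⟨G.continuous.continuousOn.add ((hQc.mono inter_subset_left).clog fun z hz => hz.2),
      fun z hz => ?_⟩
    rw [hL, Complex.exp_add, Complex.exp_log (Complex.slitPlane_ne_zero hz.2), hQ, mul_left_comm,
      ← Complex.exp_add, add_neg_cancel, Complex.exp_zero, mul_one]
  have hLp : L p = c := by
    have hp := D.base_mem_arc x hx
    rw [hL]; simp only; rw [hQ1 p hp, Complex.log_one, add_zero, hGg p hp, hgp]
  have heq : ∀ x' ∈ X, α x' ⊆ N → g x' x' = L x' := fun x' hx' hN' => by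
    obtain ⟨h1, h2⟩ := hg x' hx' (hN'.trans inter_subset_left)
    exact h1.eqOn (hLlog.mono hN') (D.arc_isPreconnected x' hx') (D.base_mem_arc x' hx')
      (h2.trans hLp.symm) (D.self_mem x' hx')
  have hLc : ContinuousWithinAt L {x | x ∈ X ∧ α x ⊆ W} x :=
    (hLlog.1.continuousAt (hNo.mem_nhds (hxN (D.self_mem x hx)))).continuousWithinAt
  refine hLc.congr_of_eventuallyEq ?_ (heq x hx hxN)
  have := (D.usc x hx N hNo hxN).filter_mono
    (nhdsWithin_mono x (fun z hz => hz.1 : {x | x ∈ X ∧ α x ⊆ W} ⊆ X))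
  filter_upwards [this, self_mem_nhdsWithin] with x' h1 h2 using heq x' h2.1 h1

lemma continuousOn_div (a b : ℂ) : ContinuousOn (fun z => (z - a) / (z - b)) ({a, b}ᶜ : Set ℂ) :=
  ContinuousOn.div (by fun_prop) (by fun_prop) fun z hz h => hz (by simp [sub_eq_zero.1 h])

lemma div_ne_zero_of_mem {a b z : ℂ} (hz : z ∈ ({a, b}ᶜ : Set ℂ)) : (z - a) / (z - b) ≠ 0 :=
  div_ne_zero (fun h => hz (by simp [sub_eq_zero.1 h])) fun h => hz (by simp [sub_eq_zero.1 h])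

lemma isOpen_pair_compl (a b : ℂ) : IsOpen ({a, b}ᶜ : Set ℂ) :=
  (Set.toFinite {a, b}).isClosed.isOpen_compl

lemma isPreconnected_compl (D : ArcFan X E p α) : IsPreconnected Xᶜ := by
  refine isPreconnected_of_forall_pair fun a ha b hb => ?_
  refine ⟨connectedComponentIn Xᶜ a, connectedComponentIn_subset _ _, mem_connectedComponentIn ha,
    ?_, isPreconnected_connectedComponentIn⟩
  refine mem_of_hasLogOn_div D.isCompact ha hb ?_ (isOpen_component D.isCompact.isClosed a)
    (frontier_component_subset D.isCompact.isClosed a) (mem_connectedComponentIn ha)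
  refine (D.lift (isOpen_pair_compl a b) (continuousOn_div a b) fun z => div_ne_zero_of_mem).mono
    fun x hx => ⟨hx, fun z hz h => ?_⟩
  have hzX := D.arc_sub x hx hz
  rcases h with rfl | h
  · exact ha hzX
  · rw [mem_singleton_iff.1 h] at hzX; exact hb hzX

lemma mem_closure_compl (D : ArcFan X E p α) {e : ℂ} (he : e ∈ E) : e ∈ closure Xᶜ := by
  rw [closure_compl, mem_compl_iff, mem_interior_iff_mem_nhds]
  intro hX
  obtain ⟨ε, hε, hball⟩ := Metric.nhds_basis_closedBall.mem_iff.1 hX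
  refine not_hasLogOn_sphere (Metric.mem_ball_self hε) ((D.lift (W := {e}ᶜ)
    isOpen_compl_singleton (F := fun z => z - e) (by fun_prop)
    fun z hz h => hz (sub_eq_zero.1 h)).mono fun x hx => ?_)
  have hxX := hball (Metric.sphere_subset_closedBall hx)
  refine ⟨hxX, fun z hz h => ?_⟩
  rw [mem_singleton_iff.1 h] at hz
  rw [D.max e he x hxX hz, Metric.mem_sphere, dist_self] at hx
  exact hε.ne hx

lemma hasLogOn_compl (D : ArcFan X E p α) {y m : ℂ} (hy : y ∈ X) (hm : m ∈ X) :
    HasLogOn (fun z => (z - y) / (z - m)) Xᶜ :=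
  hasLogOn_of_compact D.isCompact.isClosed.isOpen_compl D.isPreconnected_compl fun _ hKU hK =>
    hasLogOn_div_of_isPreconnected hK.isClosed D.isPreconnected (fun _ hz hzK => hKU hzK hz) hy hm

end ArcFan


/-- The points of `X` whose arc avoids `y` and `m`. -/
def freeSet (X : Set ℂ) (α : ℂ → Set ℂ) (y m : ℂ) : Set ℂ :=
  {x | x ∈ X ∧ α x ⊆ ({y, m}ᶜ : Set ℂ)}

open Classical in
/-- The function equal to `ℓX + 2πi * k` on `X` and to `ℓU` off `X`. -/
noncomputable def branch (X : Set ℂ) (ℓX ℓU : ℂ → ℂ) (k : ℤ) (z : ℂ) : ℂ :=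
  if z ∈ X then ℓX z + k * (2 * Real.pi * Complex.I) else ℓU z

/-- Logarithms of `(z - y) / (z - m)` along the arcs of a fan and on its complement. -/
structure BranchData (X E : Set ℂ) (p : ℂ) (α : ℂ → Set ℂ) (y m : ℂ) (ℓX ℓU : ℂ → ℂ) : Prop where
  fan : ArcFan X E p α
  y_mem : y ∈ E
  m_mem : m ∈ X
  m_notMem : m ∉ α y
  logX : IsLogOn ℓX (fun z => (z - y) / (z - m)) (freeSet X α y m)
  logU : IsLogOn ℓU (fun z => (z - y) / (z - m)) Xᶜ

/-- A segment from a point of the complement to a nearest point of `X`, along which the branch of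
index `k` is continuous. -/
structure Access (X : Set ℂ) (α : ℂ → Set ℂ) (y m : ℂ) (ℓX ℓU : ℂ → ℂ) (k : ℤ) (d u : ℂ) :
    Prop where
  d_mem : d ∈ freeSet X α y m
  u_mem : u ∈ Xᶜ
  ball : Metric.ball u (dist u d) ⊆ Xᶜ
  cont : ContinuousOn (branch X ℓX ℓU k) (segment ℝ d u)

/-- A continuum missing `E` along which the branch of index `k` is continuous, meeting both `X`
and its complement. -/
def Good (X E : Set ℂ) (α : ℂ → Set ℂ) (y m : ℂ) (ℓX ℓU : ℂ → ℂ) (k : ℤ) : Prop :=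
  ∃ H, IsCompact H ∧ IsPreconnected H ∧ H ⊆ Xᶜ ∪ freeSet X α y m ∧ Disjoint H E ∧
    (H ∩ Xᶜ).Nonempty ∧ (H ∩ X).Nonempty ∧ ContinuousOn (branch X ℓX ℓU k) H

/-- `Λ` is a logarithm on a ball extending `ℓX`. -/
structure LocalLog (X : Set ℂ) (α : ℂ → Set ℂ) (y m : ℂ) (ℓX Λ : ℂ → ℂ) (x : ℂ) (r : ℝ) :
    Prop where
  pos : 0 < r
  log : IsLogOn Λ (fun z => (z - y) / (z - m)) (Metric.ball x r)
  sub : ∀ z ∈ Metric.ball x r, z ∈ X → z ∈ freeSet X α y m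
  eq : ∀ z ∈ Metric.ball x r, z ∈ X → Λ z = ℓX z

lemma dist_lt_of_mem_segment {d u z : ℂ} (hz : z ∈ segment ℝ d u) (hzd : z ≠ d) :
    z ∈ Metric.ball u (dist u d) := by
  rw [segment_eq_image'] at hz
  obtain ⟨t, ht, rfl⟩ := hz
  have ht0 : 0 < t := lt_of_le_of_ne ht.1 fun h => hzd (by simp [← h])
  have hdu : 0 < ‖u - d‖ := norm_pos_iff.2 fun h => hzd (by simp [h])
  rw [Metric.mem_ball, dist_eq_norm, dist_eq_norm]
  have : d + t • (u - d) - u = ((t - 1 : ℝ) : ℂ) * (u - d) := by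
    rw [Complex.real_smul]; push_cast; ring
  rw [this, norm_mul, Complex.norm_real, Real.norm_eq_abs, abs_of_nonpos (by linarith [ht.2])]
  nlinarith

lemma isCompact_segment (d u : ℂ) : IsCompact (segment ℝ d u) := by
  rw [segment_eq_image']
  exact isCompact_Icc.image (by fun_prop)

lemma isPreconnected_segment (d u : ℂ) : IsPreconnected (segment ℝ d u) :=
  (convex_segment d u).isPreconnected

namespace LocalLog

variable {X : Set ℂ} {α : ℂ → Set ℂ} {y m : ℂ} {ℓX Λ : ℂ → ℂ}

lemma mono {x x' : ℂ} {r r' : ℝ} (h : LocalLog X α y m ℓX Λ x r) (hr' : 0 < r')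
    (hsub : Metric.ball x' r' ⊆ Metric.ball x r) : LocalLog X α y m ℓX Λ x' r' :=
  ⟨hr', h.log.mono hsub, fun z hz => h.sub z (hsub hz), fun z hz => h.eq z (hsub hz)⟩

end LocalLog

namespace Access

variable {X : Set ℂ} {α : ℂ → Set ℂ} {y m : ℂ} {ℓX ℓU : ℂ → ℂ} {k : ℤ} {d u : ℂ}

lemma eq_of_mem (h : Access X α y m ℓX ℓU k d u) {z : ℂ} (hz : z ∈ segment ℝ d u) (hzX : z ∈ X) :
    z = d := by
  by_contra hne
  exact h.ball (dist_lt_of_mem_segment hz hne) hzX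

lemma ne (h : Access X α y m ℓX ℓU k d u) : d ≠ u := fun e =>
  h.u_mem (e ▸ h.d_mem.1)

lemma sub (h : Access X α y m ℓX ℓU k d u) : segment ℝ d u ⊆ Xᶜ ∪ freeSet X α y m := by
  intro z hz
  by_cases hzX : z ∈ X
  · rw [h.eq_of_mem hz hzX]; exact Or.inr h.d_mem
  · exact Or.inl hzX

lemma good {E : Set ℂ} (h : Access X α y m ℓX ℓU k d u) (hEX : E ⊆ X) (hd : d ∉ E) :
    Good X E α y m ℓX ℓU k := by
  refine ⟨segment ℝ d u, isCompact_segment d u, isPreconnected_segment d u, h.sub, ?_,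
    ⟨u, right_mem_segment ℝ d u, h.u_mem⟩, ⟨d, left_mem_segment ℝ d u, h.d_mem.1⟩, h.cont⟩
  rw [disjoint_left]
  intro z hz hzE
  rw [h.eq_of_mem hz (hEX hzE)] at hzE
  exact hd hzE

end Access

namespace BranchData

variable {X E : Set ℂ} {p : ℂ} {α : ℂ → Set ℂ} {y m : ℂ} {ℓX ℓU : ℂ → ℂ}

lemma branch_of_mem (ℓX ℓU : ℂ → ℂ) (k : ℤ) {z : ℂ} (hz : z ∈ X) :
    branch X ℓX ℓU k z = ℓX z + k * (2 * Real.pi * Complex.I) := if_pos hz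

lemma branch_of_notMem (ℓX ℓU : ℂ → ℂ) (k : ℤ) {z : ℂ} (hz : z ∈ Xᶜ) :
    branch X ℓX ℓU k z = ℓU z := if_neg hz

lemma exp_add_int (w : ℂ) (k : ℤ) :
    Complex.exp (w + k * (2 * Real.pi * Complex.I)) = Complex.exp w := by
  rw [Complex.exp_add, Complex.exp_int_mul_two_pi_mul_I, mul_one]

variable (D : BranchData X E p α y m ℓX ℓU)
include D

lemma y_notMem_free : y ∉ freeSet X α y m := fun h =>
  h.2 (D.fan.self_mem y h.1) (Or.inl rfl)

lemma m_notMem_free : m ∉ freeSet X α y m := fun h =>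
  h.2 (D.fan.self_mem m h.1) (Or.inr rfl)

lemma y_ne_m : y ≠ m := fun h =>
  D.m_notMem (h ▸ D.fan.self_mem y (D.fan.sub D.y_mem))

lemma sub_pair_compl : Xᶜ ∪ freeSet X α y m ⊆ ({y, m}ᶜ : Set ℂ) := by
  rintro z hz (rfl | h)
  · rcases hz with hz | hz
    · exact hz (D.fan.sub D.y_mem)
    · exact D.y_notMem_free hz
  · rw [mem_singleton_iff.1 h] at hz
    rcases hz with hz | hz
    · exact hz D.m_mem
    · exact D.m_notMem_free hz

lemma arc_sub_free {x : ℂ} (hx : x ∈ freeSet X α y m) : α x ⊆ freeSet X α y m := fun w hw =>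
  ⟨D.fan.arc_sub x hx.1 hw, (D.fan.trans x hx.1 w hw).trans hx.2⟩


lemma exp_branch (k : ℤ) {z : ℂ} (hz : z ∈ Xᶜ ∪ freeSet X α y m) :
    Complex.exp (branch X ℓX ℓU k z) = (z - y) / (z - m) := by
  by_cases h : z ∈ X
  · rw [branch_of_mem ℓX ℓU k h, exp_add_int]
    exact D.logX.2 z (hz.resolve_left fun h' => h' h)
  · rw [branch_of_notMem ℓX ℓU k h]
    exact D.logU.2 z h

lemma continuousOn_branch_compl (k : ℤ) : ContinuousOn (branch X ℓX ℓU k) Xᶜ :=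
  D.logU.1.congr fun _ hz => branch_of_notMem ℓX ℓU k hz

lemma continuousOn_branch_free (k : ℤ) : ContinuousOn (branch X ℓX ℓU k) (freeSet X α y m) :=
  (D.logX.1.add continuousOn_const).congr fun _ hz => branch_of_mem ℓX ℓU k hz.1

lemma isLogOn_branch {k : ℤ} {s : Set ℂ} (hs : s ⊆ Xᶜ ∪ freeSet X α y m)
    (hc : ContinuousOn (branch X ℓX ℓU k) s) :
    IsLogOn (branch X ℓX ℓU k) (fun z => (z - y) / (z - m)) s :=
  ⟨hc, fun _ hz => D.exp_branch k (hs hz)⟩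

lemma exists_localLog {x : ℂ} (hx : x ∈ freeSet X α y m) :
    ∃ Λ r, LocalLog X α y m ℓX Λ x r := by
  set W : Set ℂ := {y, m}ᶜ
  have hW : IsOpen W := ArcFan.isOpen_pair_compl y m
  set Q : ℂ → ℂ := fun z => (z - y) / (z - m) * Complex.exp (-ℓX x) with hQ
  have hQc : ContinuousOn Q W := (ArcFan.continuousOn_div y m).mul continuousOn_const
  set N := W ∩ Q ⁻¹' Complex.slitPlane
  have hN : IsOpen N := hQc.isOpen_inter_preimage hW Complex.isOpen_slitPlane
  have hxW : x ∈ W := D.sub_pair_compl (Or.inr hx)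
  have hQx : Q x = 1 := by
    have : Complex.exp (ℓX x) = (x - y) / (x - m) := D.logX.2 x hx
    simp only [hQ]
    rw [← this, Complex.exp_neg, mul_inv_cancel₀ (Complex.exp_ne_zero _)]
  have hxN : x ∈ N := ⟨hxW, by rw [mem_preimage, hQx]; exact Complex.one_mem_slitPlane⟩
  set Λ : ℂ → ℂ := fun z => ℓX x + Complex.log (Q z) with hΛ
  have hlog : IsLogOn Λ (fun z => (z - y) / (z - m)) N := by
    refine ⟨continuousOn_const.add ((hQc.mono inter_subset_left).clog fun z hz => hz.2),
      fun z hz => ?_⟩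
    rw [hΛ, Complex.exp_add, Complex.exp_log (Complex.slitPlane_ne_zero hz.2), hQ, mul_left_comm,
      ← Complex.exp_add, add_neg_cancel, Complex.exp_zero, mul_one]
  have hΛx : Λ x = ℓX x := by simp [hΛ, hQx]
  have hfree : ∀ᶠ z in 𝓝 x, z ∈ X → z ∈ freeSet X α y m := by
    have := D.fan.usc x hx.1 W hW hx.2
    rw [eventually_nhdsWithin_iff] at this
    filter_upwards [this] with z hz hzX using ⟨hzX, hz hzX⟩
  have heq : ∀ᶠ z in 𝓝 x, z ∈ freeSet X α y m → Λ z = ℓX z := by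
    rw [← eventually_nhdsWithin_iff]
    have hc : ContinuousWithinAt (fun z => Λ z - ℓX z) (freeSet X α y m) x :=
      ((hlog.1.continuousAt (hN.mem_nhds hxN)).continuousWithinAt).sub (D.logX.1 x hx)
    have h1 := hc (Metric.ball_mem_nhds _ one_pos)
    filter_upwards [h1, self_mem_nhdsWithin, mem_nhdsWithin_of_mem_nhds (hN.mem_nhds hxN)]
      with z hz hzf hzN
    have hz' : ‖Λ z - ℓX z‖ < 1 := by simpa [hΛx] using hz
    refine sub_eq_zero.1 (eq_zero_of_exp_eq_one ?_ hz')
    rw [Complex.exp_sub, hlog.2 z hzN, D.logX.2 z hzf, div_self]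
    exact ArcFan.div_ne_zero_of_mem hzN.1
  have hNe : ∀ᶠ z in 𝓝 x, z ∈ N := hN.mem_nhds hxN
  obtain ⟨r, hr, hball⟩ := Metric.mem_nhds_iff.1 (hNe.and (hfree.and heq))
  exact ⟨Λ, r, hr, hlog.mono fun z hz => (hball hz).1, fun z hz hzX => (hball hz).2.1 hzX,
    fun z hz hzX => (hball hz).2.2 ((hball hz).2.1 hzX)⟩

lemma exists_nearest {u v : ℂ} (hv : v ∈ X) :
    ∃ d ∈ X, Metric.ball u (dist u d) ⊆ Xᶜ ∧ dist u d ≤ dist u v := by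
  obtain ⟨d, hd, hdist⟩ := D.fan.isCompact.exists_infDist_eq_dist ⟨v, hv⟩ u
  refine ⟨d, hd, fun z hz hzX => ?_, ?_⟩
  · have := Metric.infDist_le_dist_of_mem hzX (x := u)
    rw [Metric.mem_ball, dist_comm] at hz
    linarith
  · rw [← hdist]; exact Metric.infDist_le_dist_of_mem hv

lemma exists_access_near {Λ : ℂ → ℂ} {v u : ℂ} {r : ℝ} (hΛ : LocalLog X α y m ℓX Λ v r)
    (hv : v ∈ X) (hu : u ∈ Xᶜ) (huv : dist u v < r / 3) :
    ∃ d, dist d v ≤ 2 * dist u v ∧ ∀ k : ℤ, ℓU u = Λ u + k * (2 * Real.pi * Complex.I) →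
      Access X α y m ℓX ℓU k d u := by
  obtain ⟨d, hdX, hball, hdist⟩ := D.exists_nearest (u := u) hv
  have hdv : dist d v ≤ 2 * dist u v := by
    have := dist_triangle d u v
    rw [dist_comm d u] at this
    linarith
  refine ⟨d, hdv, fun k hk => ?_⟩
  have hr := hΛ.pos
  have hd : d ∈ Metric.ball v r := by rw [Metric.mem_ball]; linarith
  have hsub : Metric.ball u (dist u d) ⊆ Metric.ball v r := by
    intro z hz
    rw [Metric.mem_ball] at hz ⊢
    have := dist_triangle z u v
    linarith
  have hpos : 0 < dist u d := dist_pos.2 fun e => hu (e ▸ hdX)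
  have hlog : IsLogOn (fun z => Λ z + k * (2 * Real.pi * Complex.I))
      (fun z => (z - y) / (z - m)) (Metric.ball v r) :=
    ⟨hΛ.log.1.add continuousOn_const, fun z hz => by rw [exp_add_int]; exact hΛ.log.2 z hz⟩
  have heq := (D.logU.mono hball).eqOn (hlog.mono hsub) (convex_ball u _).isPreconnected
    (Metric.mem_ball_self hpos) hk
  have key : ∀ z ∈ segment ℝ d u, z ∈ Metric.ball v r ∧
      branch X ℓX ℓU k z = Λ z + k * (2 * Real.pi * Complex.I) := by
    intro z hz
    rcases eq_or_ne z d with rfl | hzd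
    · exact ⟨hd, by rw [branch_of_mem ℓX ℓU k hdX, hΛ.eq z hd hdX]⟩
    · have hzb := dist_lt_of_mem_segment hz hzd
      exact ⟨hsub hzb, by rw [branch_of_notMem ℓX ℓU k (hball hzb)]; exact heq hzb⟩
  exact ⟨hΛ.sub d hd hdX, hu, hball, (hlog.1.mono fun z hz => (key z hz).1).congr
    fun z hz => (key z hz).2⟩

lemma exists_int {Λ : ℂ → ℂ} {v u : ℂ} {r : ℝ} (hΛ : LocalLog X α y m ℓX Λ v r)
    (hu : u ∈ Xᶜ) (huv : u ∈ Metric.ball v r) :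
    ∃ k : ℤ, ℓU u = Λ u + k * (2 * Real.pi * Complex.I) :=
  Complex.exp_eq_exp_iff_exists_int.1 ((D.logU.2 u hu).trans (hΛ.log.2 u huv).symm)

/-- There are accesses of two different indices. -/
lemma exists_two_accesses : ∃ k₁ k₂ d₁ d₂ u₁ u₂, k₁ ≠ k₂ ∧ Access X α y m ℓX ℓU k₁ d₁ u₁ ∧
    Access X α y m ℓX ℓU k₂ d₂ u₂ := by
  by_contra hcon
  push Not at hcon
  obtain ⟨k, hk⟩ : ∃ k : ℤ, ∀ k' d u, Access X α y m ℓX ℓU k' d u → k' = k := by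
    by_cases h : ∃ k d u, Access X α y m ℓX ℓU k d u
    · obtain ⟨k, d, u, h⟩ := h
      refine ⟨k, fun k' d' u' h' => ?_⟩
      by_contra hne
      exact hcon k' k d' d u' u hne h' h
    · exact ⟨0, fun k' d u h' => absurd ⟨k', d, u, h'⟩ h⟩
  have hXo : IsOpen Xᶜ := D.fan.isCompact.isClosed.isOpen_compl
  have hc : ContinuousOn (branch X ℓX ℓU k) (Xᶜ ∪ freeSet X α y m) := by
    rintro z (hz | hz)
    · exact ((D.continuousOn_branch_compl k).continuousAt (hXo.mem_nhds hz)).continuousWithinAt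
    · obtain ⟨Λ, r, hΛ⟩ := D.exists_localLog hz
      have hr := hΛ.pos
      have hc : ContinuousAt (fun w => Λ w + k * (2 * Real.pi * Complex.I)) z :=
        (hΛ.log.1.continuousAt (Metric.ball_mem_nhds z hr)).add continuousAt_const
      refine (hc.congr ?_).continuousWithinAt
      filter_upwards [Metric.ball_mem_nhds z (by positivity : 0 < r / 3)] with w hw
      have hwr : w ∈ Metric.ball z r := Metric.ball_subset_ball (by linarith) hw
      by_cases hwX : w ∈ X
      · rw [branch_of_mem ℓX ℓU k hwX, hΛ.eq w hwr hwX]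
      · obtain ⟨k', hk'⟩ := D.exists_int hΛ hwX hwr
        obtain ⟨d, -, hd⟩ := D.exists_access_near hΛ hz.1 hwX hw
        rw [branch_of_notMem ℓX ℓU k hwX, hk', hk k' d w (hd k' hk')]
  have hlog := D.isLogOn_branch Subset.rfl hc
  have hyX := D.fan.sub D.y_mem
  have hus := D.fan.usc y hyX {m}ᶜ isOpen_compl_singleton
    fun z hz h => D.m_notMem (mem_singleton_iff.1 h ▸ hz)
  rw [eventually_nhdsWithin_iff] at hus
  obtain ⟨r, hr, hball⟩ := Metric.nhds_basis_closedBall.mem_iff.1 hus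
  have hm : r < dist m y := by
    by_contra! h
    exact hball (Metric.mem_closedBall.2 h) D.m_mem (D.fan.self_mem m D.m_mem) rfl
  have hsph : Metric.sphere y r ⊆ Xᶜ ∪ freeSet X α y m := by
    intro z hz
    by_cases hzX : z ∈ X
    · refine Or.inr ⟨hzX, ?_⟩
      rintro w hw (rfl | h)
      · have := D.fan.max w D.y_mem z hzX hw
        rw [this, Metric.mem_sphere, dist_self] at hz
        exact hr.ne hz
      · exact hball (Metric.sphere_subset_closedBall hz) hzX hw h
    · exact Or.inl hzX
  have hym : y - m ≠ 0 := sub_ne_zero.2 D.y_ne_m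
  have hsl : ∀ z ∈ Metric.sphere y r, 1 + (z - y) / (y - m) ∈ Complex.slitPlane := by
    intro z hz
    apply Complex.mem_slitPlane_of_norm_lt_one
    rw [mem_sphere_iff_norm] at hz
    rw [norm_div, hz, div_lt_one (norm_pos_iff.2 hym), ← dist_eq_norm, dist_comm]
    exact hm
  have h2 : HasLogOn (fun z => z - m) (Metric.sphere y r) := by
    refine ⟨fun z => Complex.log (y - m) + Complex.log (1 + (z - y) / (y - m)),
      continuousOn_const.add (ContinuousOn.clog (by fun_prop) hsl), fun z hz => ?_⟩
    rw [Complex.exp_add, Complex.exp_log hym,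
      Complex.exp_log (Complex.slitPlane_ne_zero (hsl z hz))]
    field_simp
    ring
  refine not_hasLogOn_sphere (Metric.mem_ball_self hr)
    (((show HasLogOn _ _ from ⟨_, hlog.mono hsph⟩).mul h2).congr fun z hz => ?_)
  have : z - m ≠ 0 := fun h => D.sub_pair_compl (hsph hz) (Or.inr (sub_eq_zero.1 h))
  field_simp

/-- Two good continua of different indices give a separator. -/
lemma exists_separator {k₁ k₂ : ℤ} (hk : k₁ ≠ k₂) (h₁ : Good X E α y m ℓX ℓU k₁)
    (h₂ : Good X E α y m ℓX ℓU k₂) :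
    ∃ S, IsClosed S ∧ Disjoint S E ∧ y ∉ S ∧ m ∉ S ∧
      ∀ C, IsPreconnected C → C ⊆ Sᶜ → y ∈ C → m ∉ C := by
  obtain ⟨H₁, c₁, p₁, s₁, e₁, ⟨u₁, hu₁, hu₁X⟩, ⟨x₁, hx₁, hx₁X⟩, b₁⟩ := h₁
  obtain ⟨H₂, c₂, p₂, s₂, e₂, ⟨u₂, hu₂, hu₂X⟩, ⟨x₂, hx₂, hx₂X⟩, b₂⟩ := h₂
  obtain ⟨P, hP, hPc, hPX, hu₁P, hu₂P⟩ := exists_compact_preconnected_joining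
    D.fan.isCompact.isClosed.isOpen_compl D.fan.isPreconnected_compl hu₁X hu₂X
  have hf₁ : x₁ ∈ freeSet X α y m := (s₁ hx₁).resolve_left fun h => h hx₁X
  have hf₂ : x₂ ∈ freeSet X α y m := (s₂ hx₂).resolve_left fun h => h hx₂X
  have hαE : ∀ x ∈ X, x ∉ E → Disjoint (α x) E := fun x hx hxE => by
    rw [disjoint_left]
    intro e he heE
    exact hxE (D.fan.max e heE x hx he ▸ heE)
  have hsub : H₁ ∪ H₂ ∪ P ∪ α x₁ ∪ α x₂ ⊆ Xᶜ ∪ freeSet X α y m := by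
    refine union_subset (union_subset (union_subset (union_subset s₁ s₂) ?_) ?_) ?_
    · exact hPX.trans subset_union_left
    · exact (D.arc_sub_free hf₁).trans subset_union_right
    · exact (D.arc_sub_free hf₂).trans subset_union_right
  have hcl : IsClosed (H₁ ∪ H₂ ∪ P ∪ α x₁ ∪ α x₂) :=
    ((((c₁.union c₂).union hP).union (D.fan.arc_isCompact x₁ hx₁X)).union
      (D.fan.arc_isCompact x₂ hx₂X)).isClosed
  refine ⟨H₁ ∪ H₂ ∪ P ∪ α x₁ ∪ α x₂, hcl, ?_, fun h => D.sub_pair_compl (hsub h) (Or.inl rfl),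
    fun h => D.sub_pair_compl (hsub h) (Or.inr rfl), ?_⟩
  · refine disjoint_union_left.2 ⟨disjoint_union_left.2 ⟨disjoint_union_left.2
      ⟨disjoint_union_left.2 ⟨e₁, e₂⟩, ?_⟩, ?_⟩, ?_⟩
    · exact disjoint_left.2 fun z hz hzE => hPX hz (D.fan.sub hzE)
    · exact hαE x₁ hx₁X (disjoint_left.1 e₁ hx₁)
    · exact hαE x₂ hx₂X (disjoint_left.1 e₂ hx₂)
  · intro C hC hCS hyC hmC
    obtain ⟨l, hl⟩ := hasLogOn_div_of_isPreconnected hcl hC (fun z hz => hCS hz) hyC hmC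
    have a₁ := (hl.mono (t := H₁) fun z hz => by simp [hz]).sub_eq_sub
      (D.isLogOn_branch s₁ b₁) p₁ hu₁ hx₁
    have a₂ := (hl.mono (t := H₂) fun z hz => by simp [hz]).sub_eq_sub
      (D.isLogOn_branch s₂ b₂) p₂ hu₂ hx₂
    have a₃ := (hl.mono (t := P) fun z hz => by simp [hz]).sub_eq_sub (D.logU.mono hPX) hPc
      hu₁P hu₂P
    have a₄ := (hl.mono (t := α x₁) fun z hz => by simp [hz]).sub_eq_sub
      (D.logX.mono (D.arc_sub_free hf₁)) (D.fan.arc_isPreconnected x₁ hx₁X)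
      (D.fan.self_mem x₁ hx₁X) (D.fan.base_mem_arc x₁ hx₁X)
    have a₅ := (hl.mono (t := α x₂) fun z hz => by simp [hz]).sub_eq_sub
      (D.logX.mono (D.arc_sub_free hf₂)) (D.fan.arc_isPreconnected x₂ hx₂X)
      (D.fan.self_mem x₂ hx₂X) (D.fan.base_mem_arc x₂ hx₂X)
    rw [branch_of_mem ℓX ℓU _ hx₁X, branch_of_notMem ℓX ℓU _ hu₁X] at a₁
    rw [branch_of_mem ℓX ℓU _ hx₂X, branch_of_notMem ℓX ℓU _ hu₂X] at a₂
    have : (k₁ : ℂ) * (2 * Real.pi * Complex.I) = k₂ * (2 * Real.pi * Complex.I) := by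
      linear_combination a₁ - a₂ - a₃ + a₄ - a₅
    exact hk (by exact_mod_cast mul_right_cancel₀ Complex.two_pi_I_ne_zero this)

end BranchData


/-- A bounded set that is not preconnected is partitioned by two disjoint open sets, the first of
which contains a given point and a neighbourhood of infinity. -/
lemma exists_partition {S : Set ℂ} (hS : ¬ IsPreconnected S) (hb : Bornology.IsBounded S) {c : ℂ}
    (hc : c ∈ S) : ∃ O₁ O₂ r, IsOpen O₁ ∧ IsOpen O₂ ∧ Disjoint O₁ O₂ ∧ S ⊆ O₁ ∪ O₂ ∧ c ∈ O₁ ∧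
      (S ∩ O₂).Nonempty ∧ ∀ z : ℂ, r < ‖z‖ → z ∈ O₁ := by
  obtain ⟨O₁, O₂, h1, h2, hd, hS, hc, hne⟩ : ∃ O₁ O₂, IsOpen O₁ ∧ IsOpen O₂ ∧ Disjoint O₁ O₂ ∧
      S ⊆ O₁ ∪ O₂ ∧ c ∈ O₁ ∧ (S ∩ O₂).Nonempty := by
    rw [IsPreconnected] at hS
    push Not at hS
    obtain ⟨u, v, hu, hv, huv, ⟨a, ha, hau⟩, ⟨b, hb, hbv⟩, hem⟩ := hS
    have hxu : ∀ x ∈ S, x ∈ u → x ∉ v := fun x hx hxu hxv => by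
      have : x ∈ S ∩ (u ∩ v) := ⟨hx, hxu, hxv⟩
      rw [hem] at this
      exact this
    have h1 : Disjoint (closure (S ∩ u)) (S ∩ v) := by
      rw [disjoint_left]
      rintro x hx ⟨hxS, hxv⟩
      obtain ⟨w, hwv, hwS, hwu⟩ := mem_closure_iff.1 hx v hv hxv
      exact hxu w hwS hwu hwv
    have h2 : Disjoint (S ∩ u) (closure (S ∩ v)) := by
      rw [disjoint_right]
      rintro x hx ⟨hxS, hxu'⟩
      obtain ⟨w, hwv, hwS, hwu⟩ := mem_closure_iff.1 hx u hu hxu'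
      exact hxu w hwS hwv hwu
    obtain ⟨P, Q, hP, hQ, hSP, hSQ, hPQ⟩ :=
      separatedNhds_iff_disjoint.2 (CompletelyNormalSpace.completely_normal h1 h2)
    rcases huv hc with hcu | hcv
    · refine ⟨P, Q, hP, hQ, hPQ, fun x hx => ?_, hSP ⟨hc, hcu⟩, ⟨b, hb, hSQ ⟨hb, hbv⟩⟩⟩
      exact (huv hx).imp (fun h => hSP ⟨hx, h⟩) fun h => hSQ ⟨hx, h⟩
    · refine ⟨Q, P, hQ, hP, hPQ.symm, fun x hx => ?_, hSQ ⟨hc, hcv⟩, ⟨a, ha, hSP ⟨ha, hau⟩⟩⟩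
      exact (huv hx).symm.imp (fun h => hSQ ⟨hx, h⟩) fun h => hSP ⟨hx, h⟩
  obtain ⟨R, hR⟩ := hb.subset_ball 0
  refine ⟨O₁ ∪ {z | R < ‖z‖}, O₂ ∩ Metric.ball 0 R, R,
    h1.union (isOpen_lt continuous_const continuous_norm), h2.inter Metric.isOpen_ball, ?_,
    fun z hz => ?_, Or.inl hc, ?_, fun z hz => Or.inr hz⟩
  · rw [disjoint_left]
    rintro z (hz | hz) ⟨hz2, hzb⟩
    · exact disjoint_left.1 hd hz hz2
    · rw [mem_ball_zero_iff] at hzb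
      exact lt_asymm hz hzb
  · exact (hS hz).imp Or.inl fun h => ⟨h, hR hz⟩
  · obtain ⟨x, hx, hx2⟩ := hne
    exact ⟨x, hx, hx2, hR hx⟩

namespace BranchData

variable {X E : Set ℂ} {p : ℂ} {α : ℂ → Set ℂ} {y m : ℂ} {ℓX ℓU : ℂ → ℂ}
variable (D : BranchData X E p α y m ℓX ℓU)
include D

/-- Every access admits another one of the same index with a different foot. -/
lemma exists_access_ne {k : ℤ} {c u : ℂ} (h : Access X α y m ℓX ℓU k c u) (hcE : c ∈ E) :
    ∃ d v, Access X α y m ℓX ℓU k d v ∧ d ≠ c := by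
  obtain ⟨Λ, r, hΛ⟩ := D.exists_localLog h.d_mem
  have hr := hΛ.pos
  have hcX := h.d_mem.1
  have hXo : IsOpen Xᶜ := D.fan.isCompact.isClosed.isOpen_compl
  have hlog : IsLogOn (fun z => Λ z + k * (2 * Real.pi * Complex.I))
      (fun z => (z - y) / (z - m)) (Metric.ball c r) :=
    ⟨hΛ.log.1.add continuousOn_const, fun z hz => by rw [exp_add_int]; exact hΛ.log.2 z hz⟩
  have hcu : 0 < dist u c := dist_pos.2 h.ne.symm
  have hpc : 0 < dist p c := dist_pos.2 fun e => D.fan.base_notMem (e ▸ hcE)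
  obtain ⟨s, hs, hsr, hsu, hsp⟩ : ∃ s, 0 < s ∧ s < r ∧ s < dist u c ∧ s < dist p c := by
    refine ⟨min r (min (dist u c) (dist p c)) / 2, by positivity, ?_, ?_, ?_⟩
    all_goals
      have hpos : 0 < min r (min (dist u c) (dist p c)) := by positivity
      have h1 := min_le_left r (min (dist u c) (dist p c))
      have h2 := (min_le_right r (min (dist u c) (dist p c)))
      have h3 := min_le_left (dist u c) (dist p c)
      have h4 := min_le_right (dist u c) (dist p c)
      linarith
  set Q : Set ℂ := {z | z ∈ Xᶜ ∧ ℓU z = Λ z + k * (2 * Real.pi * Complex.I)}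
  have hsphb : Metric.sphere c s ⊆ Metric.ball c r := fun z hz => by
    rw [Metric.mem_sphere] at hz; rw [Metric.mem_ball]; linarith
  have hseg : ∀ z ∈ segment ℝ c u, z ∈ Metric.ball c r →
      branch X ℓX ℓU k z = Λ z + k * (2 * Real.pi * Complex.I) := by
    have hi := D.isLogOn_branch h.sub h.cont
    refine fun z hz hzr => (hi.mono inter_subset_left).eqOn (hlog.mono inter_subset_right)
      ((convex_segment c u).inter (convex_ball c r)).isPreconnected
      (x := c) ⟨left_mem_segment ℝ c u, Metric.mem_ball_self hr⟩ ?_ ⟨hz, hzr⟩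
    rw [branch_of_mem ℓX ℓU k hcX, hΛ.eq c (Metric.mem_ball_self hr) hcX]
  have hivt : ∀ A : Set ℂ, IsPreconnected A → c ∈ A → ∀ q ∈ A, s < dist q c →
      ∃ z ∈ A, z ∈ Metric.sphere c s := by
    intro A hA hcA q hq hqs
    obtain ⟨z, hz, hzs⟩ := hA.intermediate_value hcA hq
      (f := fun z => dist z c) (by fun_prop) (show s ∈ Icc _ _ from ⟨by simp [hs.le], hqs.le⟩)
    exact ⟨z, hz, hzs⟩
  obtain ⟨z₁, hz₁, hz₁s⟩ := hivt _ (isPreconnected_segment c u) (left_mem_segment ℝ c u) u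
    (right_mem_segment ℝ c u) hsu
  obtain ⟨z₂, hz₂, hz₂s⟩ := hivt _ (D.fan.arc_isPreconnected c hcX) (D.fan.self_mem c hcX) p
    (D.fan.base_mem_arc c hcX) hsp
  have hz₁X : z₁ ∈ Xᶜ := fun hX => by
    rw [h.eq_of_mem hz₁ hX, Metric.mem_sphere, dist_self] at hz₁s
    exact hs.ne hz₁s
  have hz₁Q : z₁ ∈ Q := ⟨hz₁X, by
    rw [← hseg z₁ hz₁ (hsphb hz₁s), branch_of_notMem ℓX ℓU k hz₁X]⟩
  have hnorm : ∀ z ∈ Xᶜ, z ∈ Metric.ball c r →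
      ‖ℓU z - (Λ z + k * (2 * Real.pi * Complex.I))‖ < 1 → z ∈ Q := fun z hzX hzr hz => by
    refine ⟨hzX, sub_eq_zero.1 (eq_zero_of_exp_eq_one ?_ hz)⟩
    rw [Complex.exp_sub, D.logU.2 z hzX, hlog.2 z hzr, div_self]
    exact ArcFan.div_ne_zero_of_mem (D.sub_pair_compl (Or.inl hzX))
  have hcts : ∀ z ∈ Xᶜ, z ∈ Metric.ball c r →
      ContinuousAt (fun w => ℓU w - (Λ w + k * (2 * Real.pi * Complex.I))) z := fun z hzX hzr =>
    (D.logU.1.continuousAt (hXo.mem_nhds hzX)).sub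
      (hlog.1.continuousAt (Metric.isOpen_ball.mem_nhds hzr))
  obtain ⟨v, hvs, hvQ, hvX⟩ : ∃ v ∈ Metric.sphere c s, v ∈ closure Q ∧ v ∈ X := by
    by_contra! hcon
    have hQo : IsOpen (Q ∩ Metric.ball c r) := by
      rw [isOpen_iff_mem_nhds]
      rintro z ⟨⟨hzX, hz⟩, hzr⟩
      have h1 := hcts z hzX hzr (Metric.ball_mem_nhds _ one_pos)
      filter_upwards [h1, hXo.mem_nhds hzX, Metric.isOpen_ball.mem_nhds hzr] with w hw hwX hwr
      refine ⟨hnorm w hwX hwr ?_, hwr⟩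
      simpa [hz] using hw
    have hsub := (isPreconnected_sphere_complex c s).subset_of_closure_inter_subset hQo
      ⟨z₁, hz₁s, hz₁Q, hsphb hz₁s⟩ (fun z ⟨hz, hzs⟩ => by
        have hzQ : z ∈ closure Q := closure_mono inter_subset_left hz
        have hzX := hcon z hzs hzQ
        have hzr := hsphb hzs
        refine ⟨hnorm z hzX hzr ?_, hzr⟩
        obtain ⟨w, hw, hwQ⟩ := mem_closure_iff_nhds.1 hzQ _
          ((hcts z hzX hzr) (Metric.ball_mem_nhds _ one_pos))
        rw [mem_preimage, mem_ball_iff_norm, hwQ.2, sub_self, zero_sub, norm_neg] at hw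
        exact hw)
    exact (hsub hz₂s).1.1 (D.fan.arc_sub c hcX hz₂)
  have hΛv : LocalLog X α y m ℓX Λ v (r - s) := by
    refine hΛ.mono (by linarith) fun z hz => ?_
    rw [Metric.mem_sphere] at hvs
    rw [Metric.mem_ball] at hz ⊢
    have := dist_triangle z v c
    linarith
  obtain ⟨w, hwQ, hw⟩ := Metric.mem_closure_iff.1 hvQ (min ((r - s) / 3) (s / 2))
    (lt_min (by linarith) (by linarith))
  rw [dist_comm] at hw
  obtain ⟨d, hd, hacc⟩ := D.exists_access_near hΛv hvX hwQ.1 (hw.trans_le (min_le_left _ _))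
  refine ⟨d, w, hacc k hwQ.2, fun e => ?_⟩
  have := hw.trans_le (min_le_right _ _)
  rw [e, dist_comm, Metric.mem_sphere.1 hvs] at hd
  linarith

/-- The complementary domain of `y` for a continuum containing the arcs of its points in `X`. -/
lemma component_facts {J : Set ℂ} {k : ℤ} (hJ : IsCompact J) (hJc : IsPreconnected J)
    (hJs : J ⊆ Xᶜ ∪ freeSet X α y m) (hJb : ContinuousOn (branch X ℓX ℓU k) J) (hpJ : p ∈ J)
    (hJX : (J ∩ Xᶜ).Nonempty) (harc : ∀ w ∈ J, w ∈ X → α w ⊆ J) :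
    Disjoint (connectedComponentIn Jᶜ y) J ∧
      (connectedComponentIn Jᶜ y)ᶜ ⊆ Xᶜ ∪ freeSet X α y m ∧
      (∀ z ∈ X, z ∉ connectedComponentIn Jᶜ y → α z ⊆ (connectedComponentIn Jᶜ y)ᶜ) ∧
      ContinuousOn (branch X ℓX ℓU k) (connectedComponentIn Jᶜ y)ᶜ := by
  have hyJ : y ∉ J := fun h => D.sub_pair_compl (hJs h) (Or.inl rfl)
  have hmJ : m ∉ J := fun h => D.sub_pair_compl (hJs h) (Or.inr rfl)
  have hO := isOpen_component hJ.isClosed y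
  have hfr := frontier_component_subset hJ.isClosed y
  have hdis : Disjoint (connectedComponentIn Jᶜ y) J :=
    disjoint_left.2 fun z hz hzJ => connectedComponentIn_subset _ _ hz hzJ
  have hyO : y ∈ connectedComponentIn Jᶜ y := mem_connectedComponentIn hyJ
  have hlogJ := D.isLogOn_branch hJs hJb
  have hmO : m ∈ connectedComponentIn Jᶜ y := mem_of_hasLogOn_div hJ hyJ hmJ ⟨_, hlogJ⟩ hO hfr hyO
  have harcO : ∀ z ∈ X, z ∉ connectedComponentIn Jᶜ y →
      α z ⊆ (connectedComponentIn Jᶜ y)ᶜ := by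
    intro z hz hzO w hw hwO
    by_cases hzJ : z ∈ J
    · exact disjoint_left.1 hdis hwO (harc z hzJ hz hw)
    · have hpre := D.fan.diff z hz (J ∩ X) (hJ.isClosed.inter D.fan.isCompact.isClosed)
        ⟨hpJ, D.fan.base_mem⟩
        fun a ha ⟨haJ, haX⟩ => subset_inter (harc a haJ haX) (D.fan.arc_sub a haX)
      refine hzO (subset_component hpre (fun a ha haJ => ha.2 ⟨haJ, D.fan.arc_sub z hz ha.1⟩)
        ⟨w, ⟨hw, fun h => disjoint_left.1 hdis hwO h.1⟩, hwO⟩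
        ⟨D.fan.self_mem z hz, fun h => hzJ h.1⟩)
  have hsub : (connectedComponentIn Jᶜ y)ᶜ ⊆ Xᶜ ∪ freeSet X α y m := by
    intro z hz
    by_cases hzX : z ∈ X
    · refine Or.inr ⟨hzX, fun w hw h => ?_⟩
      rcases h with rfl | h
      · exact harcO z hzX hz hw hyO
      · exact harcO z hzX hz hw (mem_singleton_iff.1 h ▸ hmO)
    · exact Or.inl hzX
  refine ⟨hdis, hsub, harcO, ?_⟩
  have hFc := (ArcFan.continuousOn_div y m).mono (hsub.trans D.sub_pair_compl)
  have hF0 : ∀ z ∈ (connectedComponentIn Jᶜ y)ᶜ, (z - y) / (z - m) ≠ 0 := fun z hz =>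
    ArcFan.div_ne_zero_of_mem (D.sub_pair_compl (hsub hz))
  have hJO : J ⊆ (connectedComponentIn Jᶜ y)ᶜ := fun z hz hzO => disjoint_left.1 hdis hzO hz
  obtain ⟨-, hB⟩ := hasLogOn_of_glue hO hJ.isClosed hfr (a := fun _ => 1)
    (b := fun z => (z - y) / (z - m)) (g := fun z => -branch X ℓX ℓU k z) continuousOn_const
    (fun _ _ => one_ne_zero) hFc hF0 hJb.neg fun z hz => by
      rw [Complex.exp_neg, D.exp_branch k (hJs hz), mul_inv_cancel₀ (hF0 z (hJO hz))]
  obtain ⟨B, hB, hBp⟩ := hB.exists_eq (hJO hpJ) (D.exp_branch k (hJs hpJ))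
  have hBJ : ∀ z ∈ J, B z = branch X ℓX ℓU k z := (hB.mono hJO).eqOn hlogJ hJc hpJ hBp
  refine hB.1.congr fun z hz => ?_
  by_cases hzX : z ∈ X
  · have hzf : z ∈ freeSet X α y m := (hsub hz).resolve_left fun h => h hzX
    have hA := D.arc_sub_free hzf
    exact ((D.isLogOn_branch (hA.trans subset_union_right)
      ((D.continuousOn_branch_free k).mono hA)).eqOn (hB.mono (harcO z hzX hz))
      (D.fan.arc_isPreconnected z hzX) (D.fan.base_mem_arc z hzX) hBp.symm
      (D.fan.self_mem z hzX))
  · obtain ⟨j, hjJ, hjX⟩ := hJX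
    obtain ⟨P, hP, hPc, hPX, hPO, hzP, ⟨i, hiP, hiJ⟩⟩ := exists_compact_preconnected_hit
      D.fan.isCompact.isClosed.isOpen_compl D.fan.isPreconnected_compl hJ.isClosed hO hfr
      hzX hz hjX hjJ hdis
    exact ((D.isLogOn_branch (hPX.trans subset_union_left)
      ((D.continuousOn_branch_compl k).mono hPX)).eqOn (hB.mono hPO) hPc hiP
      (hBJ i hiJ).symm hzP)

end BranchData


namespace BranchData

variable {X E : Set ℂ} {p : ℂ} {α : ℂ → Set ℂ} {y m : ℂ} {ℓX ℓU : ℂ → ℂ}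
lemma good_of_partition {k : ℤ} {d u : ℂ} {Δ Γ O O₁ O₂ : Set ℂ} {r : ℝ} (hd : d ∈ X)
    (hu : u ∈ Xᶜ) (hball : Metric.ball u (dist u d) ⊆ Xᶜ)
    (hΔ : IsCompact Δ) (hΔc : IsPreconnected Δ) (huΔ : u ∈ Δ)
    (hΓ : IsCompact Γ) (hΓc : IsPreconnected Γ) (hdΓ : d ∈ Γ) (hΓX : Γ ⊆ X)
    (hΔΓ : (Δ ∩ Γ).Nonempty) (hO : IsOpen O) (hOc : IsPreconnected O)
    (hOJ : Disjoint O (segment ℝ d u ∪ Δ ∪ Γ)) (hfr : frontier O ⊆ segment ℝ d u ∪ Δ ∪ Γ)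
    (hOs : Oᶜ ⊆ Xᶜ ∪ freeSet X α y m) (hOb : ContinuousOn (branch X ℓX ℓU k) Oᶜ)
    (hO₁ : IsOpen O₁) (hO₂ : IsOpen O₂) (hdisj : Disjoint O₁ O₂)
    (hr : ∀ z : ℂ, r < ‖z‖ → z ∈ O₁) (hΔX : Δ ∩ X ⊆ O₁) (hdO : d ∈ O₂)
    (hE : E ∩ Oᶜ ⊆ O₁ ∪ O₂) : Good X E α y m ℓX ℓU k := by
  obtain ⟨H, hH, hHc, hHO, ⟨z, hz, hzJ⟩, ⟨w, hw, hwΓ⟩⟩ := exists_connector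
    (fun e : d = u => hu (e ▸ hd)) hΔ hΔc huΔ (fun h => disjoint_left.1 hdisj (hΔX ⟨h, hd⟩) hdO) hΓ hΓc hdΓ
    (disjoint_left.2 fun z hz hzΓ => hball hz (hΓX hzΓ)) hΔΓ hO hOc hOJ hfr hO₁ hO₂ hdisj hr
    ((inter_subset_inter_right Δ hΓX).trans hΔX) hdO
  have hHO' : H ⊆ Oᶜ := fun z hz => (hHO hz).1
  refine ⟨H, hH, hHc, hHO'.trans hOs, disjoint_left.2 fun z hz hzE =>
    (hHO hz).2 (hE ⟨hzE, hHO' hz⟩), ⟨z, hz, fun hzX => (hHO hz).2 ?_⟩, ⟨w, hw, hΓX hwΓ⟩,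
    hOb.mono hHO'⟩
  rcases hzJ with hzs | hzΔ
  · by_cases hzd : z = d
    · exact Or.inr (hzd ▸ hdO)
    · exact absurd hzX (hball (dist_lt_of_mem_segment hzs hzd))
  · exact Or.inl (hΔX ⟨hzΔ, hzX⟩)

variable (D : BranchData X E p α y m ℓX ℓU)
include D

lemma good_of_two_accesses {k : ℤ} {c d u v : ℂ} (hc : Access X α y m ℓX ℓU k c u)
    (hd : Access X α y m ℓX ℓU k d v) (hcd : c ≠ d) (hcE : c ∈ E) (hdE : d ∈ E) :
    Good X E α y m ℓX ℓU k := by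
  have hXcl := D.fan.isCompact.isClosed
  have hcX := hc.d_mem.1
  have hdX := hd.d_mem.1
  obtain ⟨δ, hδ, hδc, hδX, huδ, hvδ⟩ := exists_compact_preconnected_joining hXcl.isOpen_compl
    D.fan.isPreconnected_compl hc.u_mem hd.u_mem
  have hΓ : IsCompact (α c ∪ α d) := (D.fan.arc_isCompact c hcX).union (D.fan.arc_isCompact d hdX)
  have hΓc : IsPreconnected (α c ∪ α d) := (D.fan.arc_isPreconnected c hcX).union p
    (D.fan.base_mem_arc c hcX) (D.fan.base_mem_arc d hdX) (D.fan.arc_isPreconnected d hdX)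
  have hΓf : α c ∪ α d ⊆ freeSet X α y m :=
    union_subset (D.arc_sub_free hc.d_mem) (D.arc_sub_free hd.d_mem)
  have hΓX : α c ∪ α d ⊆ X := fun z hz => (hΓf hz).1
  have hΔ : IsCompact (segment ℝ c u ∪ δ) := (isCompact_segment c u).union hδ
  have hΔc : IsPreconnected (segment ℝ c u ∪ δ) := (isPreconnected_segment c u).union u
    (right_mem_segment ℝ c u) huδ hδc
  have hDc : IsPreconnected (segment ℝ d v ∪ (segment ℝ c u ∪ δ)) :=
    (isPreconnected_segment d v).union v (right_mem_segment ℝ d v) (Or.inr hvδ) hΔc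
  set J := segment ℝ d v ∪ (segment ℝ c u ∪ δ) ∪ (α c ∪ α d) with hJdef
  have hJ : IsCompact J := ((isCompact_segment d v).union hΔ).union hΓ
  have hcΓ : c ∈ α c ∪ α d := Or.inl (D.fan.self_mem c hcX)
  have hdΓ : d ∈ α c ∪ α d := Or.inr (D.fan.self_mem d hdX)
  have hcs := left_mem_segment ℝ c u
  have hJc : IsPreconnected J := hDc.union c (Or.inr (Or.inl hcs)) hcΓ hΓc
  have hJs : J ⊆ Xᶜ ∪ freeSet X α y m := union_subset (union_subset hd.sub (union_subset hc.sub
    (hδX.trans subset_union_left))) (hΓf.trans subset_union_right)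
  have hJb : ContinuousOn (branch X ℓX ℓU k) J := by
    have h1 := (D.continuousOn_branch_compl k).mono hδX
    have h2 := (D.continuousOn_branch_free k).mono hΓf
    exact ((hd.cont.union_of_isClosed (hc.cont.union_of_isClosed h1 (isCompact_segment c u).isClosed
      hδ.isClosed) (isCompact_segment d v).isClosed hΔ.isClosed).union_of_isClosed h2
      ((isCompact_segment d v).union hΔ).isClosed hΓ.isClosed)
  have hDX : ∀ w ∈ segment ℝ d v ∪ (segment ℝ c u ∪ δ), w ∈ X → w = d ∨ w = c := by
    rintro w (h | h | h) hwX
    · exact Or.inl (hd.eq_of_mem h hwX)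
    · exact Or.inr (hc.eq_of_mem h hwX)
    · exact absurd hwX (hδX h)
  have harc : ∀ w ∈ J, w ∈ X → α w ⊆ J := by
    have h1 : ∀ w ∈ α c ∪ α d, α w ⊆ J := by
      rintro w (hw | hw)
      · exact (D.fan.trans c hcX w hw).trans (subset_union_left.trans subset_union_right)
      · exact (D.fan.trans d hdX w hw).trans (subset_union_right.trans subset_union_right)
    rintro w (hw | hw) hwX
    · rcases hDX w hw hwX with rfl | rfl
      · exact h1 _ hdΓ
      · exact h1 _ hcΓ
    · exact h1 w hw
  obtain ⟨hdis, hOs, harcO, hOb⟩ := D.component_facts hJ hJc hJs hJb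
    (Or.inr (Or.inl (D.fan.base_mem_arc c hcX))) ⟨u, Or.inl (Or.inr (Or.inr huδ)), hc.u_mem⟩ harc
  have hO := isOpen_component hJ.isClosed y
  have hfr := frontier_component_subset hJ.isClosed y
  have hOc : IsPreconnected (connectedComponentIn Jᶜ y) := isPreconnected_connectedComponentIn
  set O := connectedComponentIn Jᶜ y with hOdef
  have hJO : J ⊆ Oᶜ := fun z hz hzO => disjoint_left.1 hdis hzO hz
  have hnp : ¬ IsPreconnected (E ∩ Oᶜ) := fun h => hcd
    (D.fan.hd _ inter_subset_left h ⟨hcE, hJO (Or.inr hcΓ)⟩ ⟨hdE, hJO (Or.inr hdΓ)⟩)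
  obtain ⟨O₁, O₂, r, hO₁, hO₂, h12, hES, hcO₁, ⟨e, ⟨heE, heO⟩, heO₂⟩, hr⟩ := exists_partition hnp
    (D.fan.isCompact.isBounded.subset (inter_subset_left.trans D.fan.sub))
    ⟨hcE, hJO (Or.inr hcΓ)⟩
  rcases hES ⟨hdE, hJO (Or.inr hdΓ)⟩ with hdO | hdO
  swap
  · refine good_of_partition hdX hd.u_mem hd.ball hΔ hΔc (Or.inr hvδ) hΓ hΓc hdΓ hΓX
      ⟨c, Or.inl hcs, hcΓ⟩ hO hOc hdis hfr hOs hOb hO₁ hO₂ h12 hr ?_ hdO hES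
    rintro w ⟨hw | hw, hwX⟩
    · rw [hc.eq_of_mem hw hwX]; exact hcO₁
    · exact absurd hwX (hδX hw)
  have heX := D.fan.sub heE
  have hne₁ : ∀ z ∈ O₁, z ≠ e := fun z hz h => disjoint_left.1 h12 hz (h ▸ heO₂)
  have heJ : e ∉ J := by
    rintro (h | h | h)
    · rcases hDX e h heX with h | h
      exacts [hne₁ d hdO h.symm, hne₁ c hcO₁ h.symm]
    · exact hne₁ c hcO₁ (D.fan.max e heE c hcX h)
    · exact hne₁ d hdO (D.fan.max e heE d hdX h)
  have hecl : e ∉ closure O := fun h => heJ (hfr (by rw [hO.frontier_eq]; exact ⟨h, heO⟩))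
  obtain ⟨ε, hε, hball⟩ := Metric.isOpen_iff.1 (isClosed_closure.isOpen_compl.inter hO₂) e
    ⟨hecl, heO₂⟩
  obtain ⟨u', hu'X, hu'⟩ := Metric.mem_closure_iff.1 (D.fan.mem_closure_compl heE) (ε / 3)
    (by positivity)
  obtain ⟨d', hd'X, hd'b, hd'd⟩ := D.exists_nearest (u := u') heX
  have hu'b : u' ∈ Metric.ball e ε := by rw [Metric.mem_ball, dist_comm]; linarith
  have hd'e : d' ∈ Metric.ball e ε := by
    have := dist_triangle d' u' e
    rw [dist_comm d' u'] at this
    rw [dist_comm] at hu'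
    rw [Metric.mem_ball]; linarith
  have hseg : segment ℝ d' u' ⊆ Metric.ball e ε := (convex_ball e ε).segment_subset hd'e hu'b
  have hballO : Metric.ball e ε ⊆ Oᶜ := fun z hz hzO => (hball hz).1 (subset_closure hzO)
  obtain ⟨P, hP, hPc, hPX, hPO, hu'P, i, hiP, hiJ⟩ := exists_compact_preconnected_hit
    hXcl.isOpen_compl D.fan.isPreconnected_compl hJ.isClosed hO hfr hu'X (hballO hu'b)
    hc.u_mem (Or.inl (Or.inr (Or.inr huδ))) hdis
  have hiD : i ∈ segment ℝ d v ∪ (segment ℝ c u ∪ δ) :=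
    hiJ.resolve_right fun h => hPX hiP (hΓX h)
  have hd'α := harcO d' hd'X (hballO hd'e)
  have hd'f : d' ∈ freeSet X α y m := (hOs (hballO hd'e)).resolve_left fun h => h hd'X
  refine good_of_partition (Δ := P ∪ (segment ℝ d v ∪ (segment ℝ c u ∪ δ)))
    (Γ := α c ∪ α d ∪ α d') hd'X hu'X hd'b (hP.union ((isCompact_segment d v).union hΔ))
    (hPc.union i hiP hiD hDc) (Or.inl hu'P) (hΓ.union (D.fan.arc_isCompact d' hd'X))
    (hΓc.union p (Or.inl (D.fan.base_mem_arc c hcX)) (D.fan.base_mem_arc d' hd'X)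
      (D.fan.arc_isPreconnected d' hd'X)) (Or.inr (D.fan.self_mem d' hd'X))
    (union_subset hΓX (D.fan.arc_sub d' hd'X)) ⟨c, Or.inr (Or.inr (Or.inl hcs)), Or.inl hcΓ⟩
    hO hOc ?_ ?_ hOs hOb hO₁ hO₂ h12 hr ?_ (hball hd'e).2 hES
  · refine (disjoint_compl_right (a := O)).mono_right ?_
    refine union_subset (union_subset (hseg.trans hballO) (union_subset hPO ?_))
      (union_subset ?_ hd'α)
    · exact subset_union_left.trans hJO
    · exact subset_union_right.trans hJO
  · refine hfr.trans ?_
    rintro z (hz | hz)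
    · exact Or.inl (Or.inr (Or.inr hz))
    · exact Or.inr (Or.inl hz)
  · rintro w ⟨hw | hw, hwX⟩
    · exact absurd hwX (hPX hw)
    · rcases hDX w hw hwX with rfl | rfl
      exacts [hdO, hcO₁]

lemma good_of_access {k : ℤ} {c u : ℂ} (h : Access X α y m ℓX ℓU k c u) :
    Good X E α y m ℓX ℓU k := by
  by_cases hcE : c ∈ E
  · obtain ⟨d, v, hd, hdc⟩ := D.exists_access_ne h hcE
    by_cases hdE : d ∈ E
    · exact D.good_of_two_accesses h hd hdc.symm hcE hdE
    · exact hd.good D.fan.sub hdE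
  · exact h.good D.fan.sub hcE

end BranchData

namespace ArcFan

variable {X E : Set ℂ} {p : ℂ} {α : ℂ → Set ℂ} (D : ArcFan X E p α)
include D

lemma exists_separator {y m : ℂ} (hy : y ∈ E) (hm : m ∈ X) (hmy : m ∉ α y) :
    ∃ S, IsClosed S ∧ Disjoint S E ∧ y ∉ S ∧ m ∉ S ∧
      ∀ C, IsPreconnected C → C ⊆ Sᶜ → y ∈ C → m ∉ C := by
  obtain ⟨ℓX, hX⟩ := D.lift (isOpen_pair_compl y m) (continuousOn_div y m)
    fun z => div_ne_zero_of_mem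
  obtain ⟨ℓU, hU⟩ := D.hasLogOn_compl (D.sub hy) hm
  have B : BranchData X E p α y m ℓX ℓU := ⟨D, hy, hm, hmy, hX, hU⟩
  obtain ⟨k₁, k₂, d₁, d₂, u₁, u₂, hk, h₁, h₂⟩ := B.exists_two_accesses
  exact B.exists_separator hk (B.good_of_access h₁) (B.good_of_access h₂)

/-- A maximal point can be separated in `E` from a neighbourhood of any point off its arc. -/
lemma exists_open_partition {y m : ℂ} (hy : y ∈ E) (hm : m ∈ X) (hmy : m ∉ α y) :
    ∃ U V, IsOpen U ∧ IsOpen V ∧ Disjoint U V ∧ E ⊆ U ∪ V ∧ y ∈ U ∧ m ∈ V := by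
  obtain ⟨S, hS, hSE, hyS, hmS, hsep⟩ := D.exists_separator hy hm hmy
  refine ⟨connectedComponentIn Sᶜ y, Sᶜ \ closure (connectedComponentIn Sᶜ y),
    isOpen_component hS y, hS.isOpen_compl.sdiff isClosed_closure,
    disjoint_left.2 fun z hz hz' => hz'.2 (subset_closure hz), fun z hz => ?_,
    mem_connectedComponentIn hyS, ?_⟩
  all_goals
    have key : ∀ z ∈ Sᶜ, z ∉ connectedComponentIn Sᶜ y →
        z ∈ Sᶜ \ closure (connectedComponentIn Sᶜ y) := fun z hz hzO => ⟨hz, fun h =>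
      hz (frontier_component_subset hS y (by
        rw [(isOpen_component hS y).frontier_eq]; exact ⟨h, hzO⟩))⟩
  · by_cases h : z ∈ connectedComponentIn Sᶜ y
    · exact Or.inl h
    · exact Or.inr (key z (fun h => disjoint_left.1 hSE h hz) h)
  · exact key m hmS fun h => hsep _ isPreconnected_connectedComponentIn
      (connectedComponentIn_subset _ _) (mem_connectedComponentIn hyS) h

lemma isAlmostZeroDimensionalSpace : IsAlmostZeroDimensionalSpace ↥E := by
  rintro ⟨e, he⟩ U hU heU
  obtain ⟨V, hV, rfl⟩ := isOpen_induced_iff.1 hU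
  have heV : e ∈ V := heU
  have heX := D.sub he
  set up : ℝ → Set ℂ := fun r => {x | x ∈ X ∧ (α x ∩ Metric.closedBall e r).Nonempty} with hup
  have hcl : ∀ x ∈ X, ∀ r, x ∉ up r → ∀ᶠ x' in 𝓝 x, x' ∉ up r := by
    intro x hx r hxr
    have := D.usc x hx (Metric.closedBall e r)ᶜ Metric.isClosed_closedBall.isOpen_compl
      fun z hz hzb => hxr ⟨hx, z, hz, hzb⟩
    rw [eventually_nhdsWithin_iff] at this
    filter_upwards [this] with x' h h'
    obtain ⟨hx', z, hz, hzb⟩ := h'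
    exact h hx' hz hzb
  have hupcl : ∀ r, IsClosed (up r) := by
    intro r
    rw [← isOpen_compl_iff, isOpen_iff_mem_nhds]
    intro x hxr
    by_cases hx : x ∈ X
    · exact hcl x hx r hxr
    · filter_upwards [D.isCompact.isClosed.isOpen_compl.mem_nhds hx] with z hz h using hz h.1
  have hupc : ∀ r, IsCompact (up r) := fun r =>
    D.isCompact.of_isClosed_subset (hupcl r) fun _ h => h.1
  obtain ⟨r, hr, hrV⟩ : ∃ r > 0, up r ⊆ V := by
    have hK : IsCompact (X \ V) := D.isCompact.diff hV
    have hloc : ∀ x ∈ X \ V, ∃ r > 0, x ∉ up r := by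
      rintro x ⟨hx, hxV⟩
      have hex : e ∈ (α x)ᶜ := fun h => hxV (D.max e he x hx h ▸ heV)
      obtain ⟨r, hr, hb⟩ := Metric.nhds_basis_closedBall.mem_iff.1
        ((D.arc_isCompact x hx).isClosed.isOpen_compl.mem_nhds hex)
      exact ⟨r, hr, fun ⟨_, z, hz, hzb⟩ => hb hzb hz⟩
    have hmono : ∀ {r s : ℝ}, r ≤ s → up r ⊆ up s := fun hrs x ⟨hx, z, hz, hzb⟩ =>
      ⟨hx, z, hz, Metric.closedBall_subset_closedBall hrs hzb⟩
    obtain ⟨r, hr, h⟩ : ∃ r > 0, ∀ x ∈ X \ V, x ∉ up r := by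
      refine hK.induction_on (p := fun s => ∃ r > 0, ∀ x ∈ s, x ∉ up r) ⟨1, one_pos, by simp⟩
        (fun s t hst ⟨r, hr, h⟩ => ⟨r, hr, fun x hx => h x (hst hx)⟩) ?_ ?_
      · rintro s t ⟨r, hr, h⟩ ⟨r', hr', h'⟩
        refine ⟨min r r', lt_min hr hr', ?_⟩
        rintro x (hx | hx) hxu
        · exact h x hx (hmono (min_le_left _ _) hxu)
        · exact h' x hx (hmono (min_le_right _ _) hxu)
      · intro x hx
        obtain ⟨r, hr, hxr⟩ := hloc x hx
        exact ⟨_, mem_nhdsWithin_of_mem_nhds (hcl x hx.1 r hxr), r, hr, fun z hz => hz⟩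
    refine ⟨r, hr, fun x hx => ?_⟩
    by_contra hxV
    exact h x ⟨hx.1, hxV⟩ hx
  refine ⟨Subtype.val ⁻¹' up r, ?_, preimage_mono hrV,
    {C | IsClopen C ∧ Subtype.val ⁻¹' up r ⊆ C}, fun C hC => hC.1, ?_⟩
  · have : Subtype.val ⁻¹' Metric.closedBall e r ∈ 𝓝 (⟨e, he⟩ : ↥E) :=
      continuous_subtype_val.continuousAt (Metric.closedBall_mem_nhds e hr)
    filter_upwards [this] with x hx
    exact ⟨D.sub x.2, x, D.self_mem x (D.sub x.2), hx⟩
  · refine subset_antisymm (subset_sInter fun C hC => hC.2) ?_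
    rintro ⟨y, hy⟩ hyC
    by_contra hyu
    have hyu' : y ∉ up r := hyu
    obtain ⟨U, W, hU, hW, hUW, hEUW, hyU, hupW⟩ : ∃ U W, IsOpen U ∧ IsOpen W ∧ Disjoint U W ∧
        E ⊆ U ∪ W ∧ y ∈ U ∧ up r ⊆ W := by
      refine (hupc r).induction_on (p := fun s => ∃ U W, IsOpen U ∧ IsOpen W ∧ Disjoint U W ∧
        E ⊆ U ∪ W ∧ y ∈ U ∧ s ⊆ W) ?_ ?_ ?_ ?_
      · exact ⟨univ, ∅, isOpen_univ, isOpen_empty, by simp, by simp, mem_univ _, Subset.rfl⟩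
      · rintro s t hst ⟨U, W, h1, h2, h3, h4, h5, h6⟩
        exact ⟨U, W, h1, h2, h3, h4, h5, hst.trans h6⟩
      · rintro s t ⟨U, W, h1, h2, h3, h4, h5, h6⟩ ⟨U', W', h1', h2', h3', h4', h5', h6'⟩
        refine ⟨U ∩ U', W ∪ W', h1.inter h1', h2.union h2', ?_, fun z hz => ?_, ⟨h5, h5'⟩,
          union_subset_union h6 h6'⟩
        · exact disjoint_union_right.2 ⟨h3.mono_left inter_subset_left,
            h3'.mono_left inter_subset_right⟩
        · rcases h4 hz with h | h
          · rcases h4' hz with h' | h'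
            exacts [Or.inl ⟨h, h'⟩, Or.inr (Or.inr h')]
          · exact Or.inr (Or.inl h)
      · rintro x ⟨hx, z, hz, hzb⟩
        obtain ⟨U, W, h1, h2, h3, h4, h5, h6⟩ := D.exists_open_partition hy hx fun hxy =>
          hyu' ⟨D.sub hy, z, D.trans y (D.sub hy) x hxy hz, hzb⟩
        exact ⟨W, mem_nhdsWithin_of_mem_nhds (h2.mem_nhds h6), U, W, h1, h2, h3, h4, h5,
          Subset.rfl⟩
    have hEc : (Subtype.val ⁻¹' W : Set ↥E) = (Subtype.val ⁻¹' U)ᶜ := by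
      ext ⟨z, hz⟩
      exact ⟨fun h h' => disjoint_left.1 hUW h' h, fun h => (hEUW hz).resolve_left h⟩
    have hclopen : IsClopen (Subtype.val ⁻¹' W : Set ↥E) := by
      refine ⟨?_, hW.preimage continuous_subtype_val⟩
      rw [hEc]
      exact (hU.preimage continuous_subtype_val).isClosed_compl
    exact disjoint_left.1 hUW hyU (hyC _ ⟨hclopen, preimage_mono hupW⟩)

end ArcFan


lemma image_sub_singleton {M : Type*} {f : ℝ → M} (hi : InjOn f (Icc 0 1)) {t s : ℝ} (ht : t ∈ Icc (0 : ℝ) 1)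
    {z : M} (h₁ : z ∈ f '' Icc 0 t) (h₂ : z ∈ f '' Icc t s) (hs : s ≤ 1) : z = f t := by
  obtain ⟨a, ha, rfl⟩ := h₁
  obtain ⟨b, hb, hab⟩ := h₂
  have : b = a := hi ⟨ht.1.trans hb.1, hb.2.trans hs⟩ ⟨ha.1, ha.2.trans ht.2⟩ hab
  rw [le_antisymm ha.2 (this ▸ hb.1)]

section Arcs

variable {M : Type*} [TopologicalSpace M]

lemma isArcWithEndpoints_reparam {f : ℝ → M} (hf : ContinuousOn f (Icc 0 1))
    (hi : InjOn f (Icc 0 1)) {t : ℝ} (h0 : 0 ≤ t) (h1 : t < 1) :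
    IsArcWithEndpoints (f '' Icc t 1) (f t) (f 1) := by
  have hmem : ∀ s ∈ Icc (0 : ℝ) 1, t + s * (1 - t) ∈ Icc t 1 := fun s hs =>
    ⟨by nlinarith [hs.1], by nlinarith [hs.2]⟩
  have hsub : Icc t 1 ⊆ Icc 0 1 := Icc_subset_Icc_left h0
  refine ⟨fun s => f (t + s * (1 - t)), hf.comp (by fun_prop) fun s hs => hsub (hmem s hs),
    fun s hs s' hs' h => ?_, ?_, by simp, by simp⟩
  · have := hi (hsub (hmem s hs)) (hsub (hmem s' hs')) h
    have hne : 1 - t ≠ 0 := by linarith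
    exact mul_right_cancel₀ hne (by linarith)
  · apply subset_antisymm
    · rintro _ ⟨s, hs, rfl⟩
      exact ⟨_, hmem s hs, rfl⟩
    · rintro _ ⟨s, hs, rfl⟩
      have hpos : 0 < 1 - t := by linarith
      refine ⟨(s - t) / (1 - t), ⟨div_nonneg (by linarith [hs.1]) hpos.le,
        (div_le_one hpos).2 (by linarith [hs.2])⟩, ?_⟩
      simp only
      rw [div_mul_cancel₀ _ hpos.ne']
      ring_nf

/-- A connected subset of an arc containing its endpoints is the whole arc. -/
lemma image_subset_of_isPreconnected [T2Space M] {f : ℝ → M} (hf : ContinuousOn f (Icc 0 1))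
    (hi : InjOn f (Icc 0 1)) {C : Set M} (hC : IsPreconnected C) (hCf : C ⊆ f '' Icc 0 1)
    (h0 : f 0 ∈ C) (h1 : f 1 ∈ C) : f '' Icc 0 1 ⊆ C := by
  rintro _ ⟨t, ht, rfl⟩
  have hc₁ : IsClosed (f '' Icc 0 t) :=
    (isCompact_Icc.image_of_continuousOn (hf.mono (Icc_subset_Icc_right ht.2))).isClosed
  have hc₂ : IsClosed (f '' Icc t 1) :=
    (isCompact_Icc.image_of_continuousOn (hf.mono (Icc_subset_Icc_left ht.1))).isClosed
  obtain ⟨z, hzC, hz₁, hz₂⟩ := isPreconnected_closed_iff.1 hC _ _ hc₁ hc₂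
    (hCf.trans (by rw [← image_union, Icc_union_Icc_eq_Icc ht.1 ht.2]))
    ⟨f 0, h0, 0, ⟨le_rfl, ht.1⟩, rfl⟩ ⟨f 1, h1, 1, ⟨ht.2, le_rfl⟩, rfl⟩
  rwa [← image_sub_singleton hi ht hz₁ hz₂ le_rfl]

lemma _root_.IsArcWithEndpoints.isCompact {A : Set M} {a b : M} (h : IsArcWithEndpoints A a b) :
    IsCompact A := by
  obtain ⟨f, hf, -, rfl, -, -⟩ := h
  exact isCompact_Icc.image_of_continuousOn hf

lemma _root_.IsArcWithEndpoints.isConnected {A : Set M} {a b : M}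
    (h : IsArcWithEndpoints A a b) : IsConnected A := by
  obtain ⟨f, hf, -, rfl, -, -⟩ := h
  exact (isConnected_Icc zero_le_one).image _ hf

lemma _root_.IsArcWithEndpoints.left_mem {A : Set M} {a b : M} (h : IsArcWithEndpoints A a b) :
    a ∈ A := by
  obtain ⟨f, -, -, rfl, rfl, -⟩ := h
  exact ⟨0, left_mem_Icc.2 zero_le_one, rfl⟩

lemma _root_.IsArcWithEndpoints.right_mem {A : Set M} {a b : M} (h : IsArcWithEndpoints A a b) :
    b ∈ A := by
  obtain ⟨f, -, -, rfl, -, rfl⟩ := h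
  exact ⟨1, right_mem_Icc.2 zero_le_one, rfl⟩

lemma _root_.IsArcWithEndpoints.image {N : Type*} [TopologicalSpace N] (φ : M ≃ₜ N) {A : Set M}
    {a b : M} (h : IsArcWithEndpoints A a b) : IsArcWithEndpoints (φ '' A) (φ a) (φ b) := by
  obtain ⟨f, hf, hi, rfl, rfl, rfl⟩ := h
  exact ⟨φ ∘ f, φ.continuous.comp_continuousOn hf, φ.injective.comp_injOn hi, image_comp _ _ _,
    rfl, rfl⟩

/-- Arcs with given endpoints are unique in a hereditarily unicoherent space. -/
lemma _root_.HereditarilyUnicoherent.arc_unique [T2Space M] {X : Set M}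
    (hX : HereditarilyUnicoherent X) {A B : Set M} {a b : M} (hA : IsArcWithEndpoints A a b)
    (hB : IsArcWithEndpoints B a b) (hAX : A ⊆ X) (hBX : B ⊆ X) : A = B := by
  have key : ∀ {A B : Set M}, IsArcWithEndpoints A a b → IsArcWithEndpoints B a b → A ⊆ X →
      B ⊆ X → A ⊆ B := by
    intro A B hA hB hAX hBX
    have hp := hX A B hAX hBX hA.isCompact hA.isConnected hB.isCompact hB.isConnected
    have ha : a ∈ A ∩ B := ⟨hA.left_mem, hB.left_mem⟩
    have hb : b ∈ A ∩ B := ⟨hA.right_mem, hB.right_mem⟩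
    obtain ⟨f, hf, hi, rfl, rfl, rfl⟩ := hA
    exact (image_subset_of_isPreconnected hf hi hp inter_subset_left ha hb).trans
      inter_subset_right
  exact subset_antisymm (key hA hB hAX hBX) (key hB hA hBX hAX)

lemma continuousOn_invFunOn_arc [T2Space M] {f : ℝ → M} (hf : ContinuousOn f (Icc 0 1))
    (hi : InjOn f (Icc 0 1)) :
    ContinuousOn (Function.invFunOn f (Icc 0 1)) (f '' Icc 0 1) := by
  rw [continuousOn_iff_isClosed]
  intro t ht
  refine ⟨f '' (Icc 0 1 ∩ t), ((isCompact_Icc.inter_right ht).image_of_continuousOn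
    (hf.mono inter_subset_left)).isClosed, ?_⟩
  ext z
  constructor
  · rintro ⟨hz, hzf⟩
    exact ⟨⟨_, ⟨Function.invFunOn_mem hzf, hz⟩, Function.invFunOn_eq hzf⟩, hzf⟩
  · rintro ⟨⟨s, ⟨hs, hst⟩, rfl⟩, hzf⟩
    refine ⟨?_, hzf⟩
    rw [mem_preimage, hi.leftInvOn_invFunOn hs]
    exact hst

lemma hasLogOn_arc [T2Space M] {A : Set M} {a b : M} (hA : IsArcWithEndpoints A a b) {F : M → ℂ}
    (hF : ContinuousOn F A) (hF0 : ∀ z ∈ A, F z ≠ 0) : HasLogOn F A := by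
  obtain ⟨f, hf, hi, rfl, -, -⟩ := hA
  have hproj : ∀ t, (projIcc (0 : ℝ) 1 zero_le_one t : ℝ) ∈ Icc (0 : ℝ) 1 := fun t => Subtype.prop _
  obtain ⟨G, hG, hGe⟩ := exists_continuous_log (F := fun t : ℝ =>
    F (f (projIcc (0 : ℝ) 1 zero_le_one t)))
    ((hF.comp hf fun t ht => mem_image_of_mem f ht).comp_continuous
      (continuous_subtype_val.comp continuous_projIcc) hproj)
    fun t => hF0 _ (mem_image_of_mem f (hproj t))
  refine ⟨fun z => G (Function.invFunOn f (Icc 0 1) z),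
    hG.comp_continuousOn (continuousOn_invFunOn_arc hf hi), fun z hz => ?_⟩
  rw [hGe, projIcc_of_mem zero_le_one (Function.invFunOn_mem hz)]
  simp only
  rw [Function.invFunOn_eq hz]

/-- An endpoint on an arc is an endpoint of that arc. -/
lemma endpoint_eq [T2Space M] {X : Set M} {e : M} (he : e ∈ Endpoints X) {A : Set M} {a b : M}
    (hA : IsArcWithEndpoints A a b) (hAX : A ⊆ X) (heA : e ∈ A) : e = a ∨ e = b := by
  obtain ⟨c, h, hh, hhi, hhA, h0, -⟩ := he.2 A hAX ⟨a, b, hA⟩ heA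
  obtain ⟨f, hf, hi, hfA, rfl, rfl⟩ := hA
  obtain ⟨t, ht, hte⟩ : e ∈ f '' Icc 0 1 := hfA ▸ heA
  rcases eq_or_lt_of_le ht.1 with rfl | ht0
  · exact Or.inl hte.symm
  rcases eq_or_lt_of_le ht.2 with rfl | ht1
  · exact Or.inr hte.symm
  exfalso
  have hsub : Ioc (0 : ℝ) 1 ⊆ Icc 0 1 := Ioc_subset_Icc_self
  have hpre : IsPreconnected (h '' Ioc 0 1) := isPreconnected_Ioc.image _ (hh.mono hsub)
  have hne : e ∉ h '' Ioc 0 1 := by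
    rintro ⟨s, hs, hse⟩
    exact hs.1.ne' (hhi (hsub hs) (left_mem_Icc.2 zero_le_one) (hse.trans h0.symm))
  have hmem : ∀ z ∈ A, z ≠ e → z ∈ h '' Ioc 0 1 := by
    intro z hz hze
    rw [← hhA] at hz
    obtain ⟨s, hs, rfl⟩ := hz
    exact ⟨s, ⟨lt_of_le_of_ne hs.1 fun h' => hze (h' ▸ h0), hs.2⟩, rfl⟩
  have hc₁ : IsClosed (f '' Icc 0 t) :=
    (isCompact_Icc.image_of_continuousOn (hf.mono (Icc_subset_Icc_right ht.2))).isClosed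
  have hc₂ : IsClosed (f '' Icc t 1) :=
    (isCompact_Icc.image_of_continuousOn (hf.mono (Icc_subset_Icc_left ht.1))).isClosed
  have hz0 : (0 : ℝ) ∈ Icc (0 : ℝ) 1 := left_mem_Icc.2 zero_le_one
  have hz1 : (1 : ℝ) ∈ Icc (0 : ℝ) 1 := right_mem_Icc.2 zero_le_one
  obtain ⟨z, hz, hz₁, hz₂⟩ := isPreconnected_closed_iff.1 hpre _ _ hc₁ hc₂
    (by
      rw [← image_union, Icc_union_Icc_eq_Icc ht.1 ht.2, hfA, ← hhA]
      exact image_mono hsub)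
    ⟨f 0, hmem _ (hfA ▸ mem_image_of_mem f hz0) fun h' => ht0.ne (hi hz0 ht (h'.trans hte.symm)),
      0, ⟨le_rfl, ht.1⟩, rfl⟩
    ⟨f 1, hmem _ (hfA ▸ mem_image_of_mem f hz1) fun h' => ht1.ne' (hi hz1 ht (h'.trans hte.symm)),
      1, ⟨ht.2, le_rfl⟩, rfl⟩
  rw [image_sub_singleton hi ht hz₁ hz₂ le_rfl, hte] at hz
  exact hne hz

lemma image_endpoints_subset {N : Type*} [TopologicalSpace N] (φ : M ≃ₜ N) (X : Set M) :
    φ '' Endpoints X ⊆ Endpoints (φ '' X) := by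
  rintro _ ⟨e, ⟨heX, he⟩, rfl⟩
  refine ⟨mem_image_of_mem φ heX, ?_⟩
  rintro A hA ⟨a, b, hab⟩ heA
  have hsymm : φ.symm '' (φ '' X) = X :=
    φ.toEquiv.symm_image_image X
  obtain ⟨c, hc⟩ := he (φ.symm '' A) (hsymm ▸ image_mono hA) ⟨_, _, hab.image φ.symm⟩
    ⟨φ e, heA, φ.symm_apply_apply e⟩
  have := hc.image φ
  rw [show φ '' (φ.symm '' A) = A from φ.toEquiv.image_symm_image A] at this
  exact ⟨_, this⟩

lemma _root_.HereditarilyUnicoherent.image {N : Type*} [TopologicalSpace N] (φ : M ≃ₜ N)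
    {X : Set M} (hX : HereditarilyUnicoherent X) : HereditarilyUnicoherent (φ '' X) := by
  intro K L hK hL hKc hKn hLc hLn
  have hsymm : φ.symm '' (φ '' X) = X :=
    φ.toEquiv.symm_image_image X
  have := hX (φ.symm '' K) (φ.symm '' L) (hsymm ▸ image_mono hK) (hsymm ▸ image_mono hL)
    (hKc.image φ.symm.continuous) (hKn.image _ φ.symm.continuous.continuousOn)
    (hLc.image φ.symm.continuous) (hLn.image _ φ.symm.continuous.continuousOn)
  rw [← image_inter φ.symm.injective] at this
  have h2 := this.image φ φ.continuous.continuousOn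
  rwa [show φ '' (φ.symm '' (K ∩ L)) = K ∩ L from φ.toEquiv.image_symm_image _] at h2

lemma _root_.HereditarilyDisconnected.image {N : Type*} [TopologicalSpace N] (φ : M ≃ₜ N)
    {X : Set M} (hX : HereditarilyDisconnected X) : HereditarilyDisconnected (φ '' X) := by
  intro S hS hSc
  have hsymm : φ.symm '' (φ '' X) = X :=
    φ.toEquiv.symm_image_image X
  have := (hX (φ.symm '' S) (hsymm ▸ image_mono hS)
    (hSc.image _ φ.symm.continuous.continuousOn)).image φ
  rwa [show φ '' (φ.symm '' S) = S from φ.toEquiv.image_symm_image S] at this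

lemma _root_.IsAlmostZeroDimensionalSpace.of_homeomorph {N : Type*} [TopologicalSpace N]
    (φ : M ≃ₜ N) (hN : IsAlmostZeroDimensionalSpace N) : IsAlmostZeroDimensionalSpace M := by
  intro x U hU hx
  obtain ⟨V, hV, hVU, 𝒞, h𝒞, rfl⟩ := hN (φ x) (φ '' U) (φ.isOpenMap U hU) (mem_image_of_mem φ hx)
  refine ⟨φ ⁻¹' ⋂₀ 𝒞, φ.continuous.continuousAt hV, fun z hz => ?_, (preimage φ) '' 𝒞, ?_, ?_⟩
  · exact (φ.injective.mem_set_image).1 (hVU hz)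
  · rintro _ ⟨C, hC, rfl⟩
    exact (h𝒞 C hC).preimage φ.continuous
  · rw [sInter_image, preimage_sInter]

end Arcs

/-- The arcs of a dendroid smooth at `p` form a fan. -/
lemma arcFan_of_smooth {X : Set ℂ} {p : ℂ} {α : ℂ → Set ℂ} (hX : IsCompact X)
    (hHU : HereditarilyUnicoherent X) (hp : p ∈ X) (hαp : α p = {p})
    (harc : ∀ x ∈ X, x ≠ p → α x ⊆ X ∧ IsArcWithEndpoints (α x) x p)
    (hconv : ∀ (xs : ℕ → ℂ) (x : ℂ), (∀ n, xs n ∈ X) → x ∈ X → Tendsto xs atTop (𝓝 x) →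
      Tendsto (fun n => Metric.hausdorffEDist (α (xs n)) (α x)) atTop (𝓝 0))
    {E : Set ℂ} (hE : E ⊆ Endpoints X) (hpE : p ∉ E) (hhd : HereditarilyDisconnected E) :
    ArcFan X E p α := by
  have hparam : ∀ x ∈ X, α x ⊆ X ∧ ∃ f : ℝ → ℂ, ContinuousOn f (Icc 0 1) ∧ f '' Icc 0 1 = α x ∧
      f 0 = x ∧ f 1 = p ∧ ∀ t ∈ Icc (0 : ℝ) 1, α (f t) = f '' Icc t 1 := by
    intro x hx
    by_cases hxp : x = p
    · subst hxp
      refine ⟨by rwa [hαp, singleton_subset_iff], fun _ => x, continuousOn_const, ?_, rfl, rfl,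
        fun t ht => ?_⟩
      · rw [hαp, (nonempty_Icc.2 zero_le_one).image_const]
      · rw [hαp, (nonempty_Icc.2 ht.2).image_const]
    · obtain ⟨hxX, f, hf, hi, hfα, h0, h1⟩ := harc x hx hxp
      refine ⟨hxX, f, hf, hfα, h0, h1, fun t ht => ?_⟩
      rcases eq_or_lt_of_le ht.2 with rfl | ht1
      · rw [h1, hαp, Icc_self, image_singleton, h1]
      · have hft : f t ∈ X := hxX (hfα ▸ mem_image_of_mem f ht)
        have hne : f t ≠ p := fun h => ht1.ne (hi ht (right_mem_Icc.2 zero_le_one) (h.trans h1.symm))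
        obtain ⟨hs, ha⟩ := harc (f t) hft hne
        refine hHU.arc_unique ha (h1 ▸ isArcWithEndpoints_reparam hf hi ht.1 ht1) hs ?_
        exact (image_mono (Icc_subset_Icc_left ht.1)).trans (hfα ▸ hxX)
  have hz0 : (0 : ℝ) ∈ Icc (0 : ℝ) 1 := left_mem_Icc.2 zero_le_one
  have hz1 : (1 : ℝ) ∈ Icc (0 : ℝ) 1 := right_mem_Icc.2 zero_le_one
  have hcpt : ∀ x ∈ X, IsCompact (α x) := fun x hx => by
    obtain ⟨-, f, hf, hfα, -⟩ := hparam x hx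
    exact hfα ▸ isCompact_Icc.image_of_continuousOn hf
  refine ⟨hX, hp, fun e he => (hE he).1, hpE, fun x hx => (hparam x hx).1, ?_, ?_, hcpt, ?_, hαp,
    ?_, ?_, ?_, ?_, ?_, hhd⟩
  · intro x hx
    obtain ⟨-, f, -, hfα, h0, -⟩ := hparam x hx
    rw [← hfα]
    exact ⟨0, hz0, h0⟩
  · intro x hx
    obtain ⟨-, f, -, hfα, -, h1, -⟩ := hparam x hx
    rw [← hfα]
    exact ⟨1, hz1, h1⟩
  · intro x hx
    obtain ⟨-, f, hf, hfα, -⟩ := hparam x hx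
    exact hfα ▸ isPreconnected_Icc.image _ hf
  · intro x hx w hw
    obtain ⟨-, f, hf, hfα, -, -, hsub⟩ := hparam x hx
    rw [← hfα] at hw ⊢
    obtain ⟨t, ht, rfl⟩ := hw
    rw [hsub t ht]
    exact image_mono (Icc_subset_Icc_left ht.1)
  · intro x hx F hF hF0
    by_cases hxp : x = p
    · rw [hxp, hαp] at hF0 ⊢
      refine ⟨fun _ => Complex.log (F p), continuousOn_const, fun z hz => ?_⟩
      rw [mem_singleton_iff.1 hz, Complex.exp_log (hF0 p rfl)]
    · exact hasLogOn_arc (harc x hx hxp).2 hF hF0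
  · intro x hx Γ hΓ hpΓ hΓα
    obtain ⟨-, f, hf, hfα, -, h1, hsub⟩ := hparam x hx
    obtain ⟨t, ht, htΓ, hlt⟩ := exists_first_hit hf hΓ hz1 (h1 ▸ hpΓ)
    have : α x \ Γ = f '' Ico 0 t := by
      rw [← hfα]
      apply subset_antisymm
      · rintro _ ⟨⟨s, hs, rfl⟩, hsΓ⟩
        refine ⟨s, ⟨hs.1, not_le.1 fun hts => hsΓ ?_⟩, rfl⟩
        refine hΓα (f t) (hfα ▸ mem_image_of_mem f ht) htΓ ?_
        rw [hsub t ht]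
        exact ⟨s, ⟨hts, hs.2⟩, rfl⟩
      · rintro _ ⟨s, hs, rfl⟩
        exact ⟨⟨s, ⟨hs.1, hs.2.le.trans ht.2⟩, rfl⟩, hlt s hs.1 hs.2⟩
    rw [this]
    exact isPreconnected_Ico.image _ (hf.mono fun s hs => ⟨hs.1, hs.2.le.trans ht.2⟩)
  · intro x hx N hN hxN
    by_contra hcon
    obtain ⟨xs, hxs, hxsN⟩ := exists_seq_forall_of_frequently (not_eventually.1 hcon)
    rw [tendsto_nhdsWithin_iff] at hxs
    obtain ⟨n₀, hn₀⟩ := eventually_atTop.1 hxs.2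
    obtain ⟨δ, hδ, hthick⟩ := (hcpt x hx).exists_thickening_subset_open hN hxN
    have ht := hconv (fun n => xs (n + n₀)) x (fun n => hn₀ _ (Nat.le_add_left _ _)) hx
      (hxs.1.comp (tendsto_add_atTop_nat n₀))
    obtain ⟨n, hn⟩ := (ht.eventually (gt_mem_nhds (ENNReal.ofReal_pos.2 hδ))).exists
    refine hxsN (n + n₀) fun z hz => hthick ?_
    rw [Metric.mem_thickening_iff_infEDist_lt]
    exact (Metric.infEDist_le_hausdorffEDist_of_mem hz).trans_lt hn
  · intro e he x hx hex
    by_cases hxp : x = p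
    · rw [hxp, hαp] at hex
      rw [hxp, ← mem_singleton_iff.1 hex]
    · obtain ⟨hxX, ha⟩ := harc x hx hxp
      rcases endpoint_eq (hE he) ha hxX hex with h | h
      · exact h.symm
      · exact absurd (h ▸ he) hpE

end PlaneLog

/-- Theorem 16. -/
theorem stmt_17 (X : Set Plane) (p : Plane) (hX : IsDendroid X) (hp : DendroidSmoothAt X p)
    (hhd : HereditarilyDisconnected (Endpoints X)) :
    IsAlmostZeroDimensionalSpace ↥(Endpoints X \ {p}) := by
  set φ := Complex.orthonormalBasisOneI.repr.symm.toHomeomorph with hφ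
  have hiso : Isometry φ := Complex.orthonormalBasisOneI.repr.symm.isometry
  obtain ⟨hpX, α, hαp, harc, hconv⟩ := hp
  have hmem : ∀ z, z ∈ φ '' X → φ.symm z ∈ X := by
    rintro _ ⟨x, hx, rfl⟩
    rwa [φ.symm_apply_apply]
  refine IsAlmostZeroDimensionalSpace.of_homeomorph (φ.image _)
    (PlaneLog.ArcFan.isAlmostZeroDimensionalSpace (X := φ '' X) (p := φ p)
      (α := fun z => φ '' α (φ.symm z)) (PlaneLog.arcFan_of_smooth (hX.1.image φ.continuous)
        (hX.2.2.1.image φ) (mem_image_of_mem φ hpX) ?_ ?_ ?_ ?_ ?_ ?_))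
  · simp [hαp]
  · intro z hz hzp
    obtain ⟨h1, h2⟩ := harc (φ.symm z) (hmem z hz) fun h => hzp (by rw [← h, φ.apply_symm_apply])
    refine ⟨image_mono h1, ?_⟩
    have := h2.image φ
    rwa [φ.apply_symm_apply] at this
  · intro zs z hzs hz ht
    have := hconv (fun n => φ.symm (zs n)) (φ.symm z) (fun n => hmem _ (hzs n)) (hmem z hz)
      ((φ.symm.continuous.tendsto z).comp ht)
    simp only [Metric.hausdorffEDist_image hiso]
    exact this
  · exact (image_mono sdiff_subset).trans (PlaneLog.image_endpoints_subset φ X)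
  · rintro ⟨x, hx, hxp⟩
    exact hx.2 (φ.injective hxp)
  · exact HereditarilyDisconnected.image φ fun S hS => hhd S (hS.trans sdiff_subset)
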